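/- arXiv:1710.05347 — 3 statements merged into one kernel-verified Lean document; each statement's English description precedes it below -/
import Mathlib

section
/- Let k ≥ 1 and r ≥ 2 be integers and n ≥ kr(k+r−2) + 2r − 1. Let G be an r-graph on n vertices with e(G) ≥ C(n,r) − (k−1)·[C(n,r) − C(n−k+1, r)] edges. Then the edge set of G can be partitioned into ⌊e(G)/k⌋ sets, each consisting of k pairwise disjoint edges, together with a remainder set of e(G) mod k edges. -/
/-- `p` is a set of `k` pairwise disjoint edges. -/
def IsMatchingSet (k : ℕ) {n : ℕ} (p : Finset (Finset (Fin n))) : Prop :=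
  p.card = k ∧ ∀ e ∈ p, ∀ f ∈ p, e ≠ f → Disjoint e f

namespace EquitableColoring

open Finset Relation Function
open scoped Classical

variable {V κ : Type*}

/-- `f` is a proper colouring of the subgraph of `G` induced on `S`. -/
def ProperOn (G : SimpleGraph V) (S : Finset V) (f : V → κ) : Prop :=
  ∀ u ∈ S, ∀ v ∈ S, G.Adj u v → f u ≠ f v

/-- The vertex `v` has no neighbour of colour `c` in `S`. -/
def Movable (G : SimpleGraph V) (S : Finset V) (f : V → κ) (v : V) (c : κ) : Prop :=
  ∀ u ∈ S, G.Adj v u → f u ≠ c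

/-- Some vertex of colour `a` can be recoloured with `b`, where `a` and `b` lie in `D`. -/
def Step (G : SimpleGraph V) (S : Finset V) (f : V → κ) (D : Finset κ) (a b : κ) : Prop :=
  a ∈ D ∧ b ∈ D ∧ ∃ y ∈ S, f y = a ∧ Movable G S f y b

/-- `b` is reached from `a` by recolouring steps inside `D`. -/
def Reach (G : SimpleGraph V) (S : Finset V) (f : V → κ) (D : Finset κ) : κ → κ → Prop :=
  ReflTransGen (Step G S f D)

variable {G : SimpleGraph V} {S : Finset V} {f : V → κ}

lemma ProperOn.mono {T : Finset V} (h : ProperOn G S f) (hT : T ⊆ S) : ProperOn G T f :=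
  fun u hu v hv => h u (hT hu) v (hT hv)

lemma ProperOn.update {y : V} {c : κ} (h : ProperOn G (S.erase y) f)
    (hc : Movable G S f y c) : ProperOn G S (update f y c) := by
  intro u hu v hv huv
  by_cases h1 : u = y
  · subst h1
    rw [update_self, update_of_ne huv.ne']
    exact (hc v hv huv).symm
  · by_cases h2 : v = y
    · subst h2
      rw [update_self, update_of_ne h1]
      exact hc u hu huv.symm
    · rw [update_of_ne h1, update_of_ne h2]
      exact h u (by simp [h1, hu]) v (by simp [h2, hv]) huv

lemma card_update {y : V} (hy : y ∈ S) (c d : κ) :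
    #{v ∈ S | update f y c v = d} + (if d = f y then 1 else 0) =
      #{v ∈ S | f v = d} + (if d = c then 1 else 0) := by
  have h : ∑ v ∈ S.erase y, (if update f y c v = d then 1 else 0) =
      ∑ v ∈ S.erase y, (if f v = d then 1 else 0) :=
    sum_congr rfl fun v hv => by rw [update_of_ne (ne_of_mem_erase hv)]
  rw [card_filter, card_filter, ← add_sum_erase S _ hy, ← add_sum_erase S _ hy, h, update_self]
  simp only [eq_comm (a := d)]
  ring

lemma Reach.cases_head_erase {D : Finset κ} {a b : κ} (h : Reach G S f D a b) :
    a = b ∨ ∃ c, c ≠ a ∧ Step G S f D a c ∧ Reach G S f (D.erase a) c b := by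
  induction h with
  | refl => exact Or.inl rfl
  | @tail b' b _ hs ih =>
    by_cases hab : a = b
    · exact Or.inl hab
    right
    rcases ih with rfl | ⟨c, hca, hac, hcb⟩
    · exact ⟨b, Ne.symm hab, hs, ReflTransGen.refl⟩
    · by_cases hb' : b' = a
      · subst hb'
        exact ⟨b, Ne.symm hab, hs, ReflTransGen.refl⟩
      · exact ⟨c, hca, hac, hcb.tail ⟨by simp [hb', hs.1], by simp [Ne.symm hab, hs.2.1], hs.2.2⟩⟩

/-- Recolouring along a path from `a` to `b` moves one unit from the class of `a` to that
of `b`. -/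
lemma Reach.exists_shift {D : Finset κ} {a b : κ} (hf : ProperOn G S f)
    (h : Reach G S f D a b) :
    ∃ f' : V → κ, ProperOn G S f' ∧ (∀ v, f v ∉ D → f' v = f v) ∧ (∀ v, f v ∈ D → f' v ∈ D) ∧
      (∀ v, f' v = a → f v = a) ∧
      ∀ d, #{v ∈ S | f' v = d} + (if d = a then 1 else 0) =
        #{v ∈ S | f v = d} + (if d = b then 1 else 0) := by
  induction hD : #D using Nat.strong_induction_on generalizing D a with
  | _ N ih =>
  rcases h.cases_head_erase with rfl | ⟨c, hca, ⟨haD, hcD, y, hyS, hya, hyc⟩, hcb⟩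
  · exact ⟨f, hf, fun _ _ => rfl, fun _ h => h, fun _ h => h, fun _ => rfl⟩
  obtain ⟨f', hp, hout, hin, hsub, hcard⟩ :=
    ih _ (by rw [← hD]; exact card_erase_lt_of_mem haD) hcb rfl
  have hy' : f' y = a := by rw [hout y (by simp [hya]), hya]
  refine ⟨Function.update f' y c, (hp.mono (erase_subset _ _)).update
    fun u hu huy h => hyc u hu huy (hsub u h), ?_, ?_, ?_, fun d => ?_⟩
  · intro v hv
    have : v ≠ y := by rintro rfl; exact hv (hya ▸ haD)
    rw [update_of_ne this, hout v fun h => hv (mem_of_mem_erase h)]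
  · intro v hv
    by_cases hvy : v = y
    · subst hvy; simpa using hcD
    · rw [update_of_ne hvy]
      by_cases hva : f v = a
      · rw [hout v (by simp [hva]), hva]; exact haD
      · exact mem_of_mem_erase (hin v (mem_erase.2 ⟨hva, hv⟩))
  · intro v hv
    by_cases hvy : v = y
    · subst hvy; simp [hca] at hv
    · rw [update_of_ne hvy] at hv
      by_contra hva
      by_cases hvD : f v ∈ D
      · exact ne_of_mem_erase (hin v (mem_erase.2 ⟨hva, hvD⟩)) hv
      · exact hva ((hout v fun h => hvD (mem_of_mem_erase h)) ▸ hv)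
  · have h1 := card_update (f := f') hyS c d
    have h2 := hcard d
    rw [hy'] at h1
    omega

/-- A path avoiding `U` consists of vertices that reach the end avoiding `U`. -/
lemma Reach.erase_of_not {D : Finset κ} {x b U W : κ} (h : Reach G S f (D.erase U) x b)
    (hW : ¬ Reach G S f (D.erase U) W b) : Reach G S f (D.erase W) x b := by
  induction h using ReflTransGen.head_induction_on with
  | refl => exact ReflTransGen.refl
  | @head x x' hs ht ih =>
    refine ReflTransGen.head ⟨?_, ?_, hs.2.2⟩ ih
    · exact mem_erase.2 ⟨fun e => hW (e ▸ ReflTransGen.head hs ht), mem_of_mem_erase hs.1⟩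
    · exact mem_erase.2 ⟨fun e => hW (e ▸ ht), mem_of_mem_erase hs.2.1⟩

/-- Replacing the colouring on `B`, with separate colours, leaves the colouring proper. -/
lemma ProperOn.piecewise {g : V → κ} {B : Finset V} {C : Finset κ} (hf : ProperOn G S f)
    (hg : ProperOn G B g) (hgC : ∀ v ∈ B, g v ∈ C) (hfC : ∀ v ∈ S, v ∉ B → f v ∉ C) :
    ProperOn G S (fun v => if v ∈ B then g v else f v) := by
  intro u hu v hv huv
  by_cases h1 : u ∈ B <;> by_cases h2 : v ∈ B <;> simp only [h1, h2, if_true, if_false]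
  · exact hg u h1 v h2 huv
  · exact fun h => hfC v hv h2 (h ▸ hgC u h1)
  · exact fun h => hfC u hu h1 (h ▸ hgC v h2)
  · exact hf u hu v hv huv

lemma card_piecewise_of_mem {g : V → κ} {B : Finset V} {C : Finset κ} (hB : B ⊆ S)
    (hfC : ∀ v ∈ S, v ∉ B → f v ∉ C) {c : κ} (hc : c ∈ C) :
    #{v ∈ S | (if v ∈ B then g v else f v) = c} = #{v ∈ B | g v = c} := by
  congr 1
  ext v
  simp only [mem_filter]
  constructor
  · rintro ⟨hv, h⟩
    by_cases hvB : v ∈ B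
    · simpa [hvB] using h
    · exact absurd (by simpa [hvB] using h) (fun e : f v = c => hfC v hv hvB (e ▸ hc))
  · rintro ⟨hv, h⟩
    exact ⟨hB hv, by simpa [hv] using h⟩

lemma card_piecewise_of_notMem {g : V → κ} {B : Finset V} {C : Finset κ}
    (hgC : ∀ v ∈ B, g v ∈ C) (hfC : ∀ v ∈ B, f v ∈ C) {c : κ} (hc : c ∉ C) :
    #{v ∈ S | (if v ∈ B then g v else f v) = c} = #{v ∈ S | f v = c} := by
  congr 1
  ext v
  simp only [mem_filter]
  refine and_congr_right fun hv => ?_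
  by_cases hvB : v ∈ B
  · simp only [hvB, if_true]
    exact ⟨fun h => absurd (h ▸ hgC v hvB) hc, fun h => absurd (h ▸ hfC v hvB) hc⟩
  · simp [hvB]

/-- `z` is the only neighbour of `y` in its colour class, where `z` has a colour in `A'` and `y`
has a colour in `B`. -/
def Solo (G : SimpleGraph V) (S : Finset V) (f : V → κ) (A' B : Finset κ) (z y : V) : Prop :=
  z ∈ S ∧ y ∈ S ∧ f z ∈ A' ∧ f y ∈ B ∧ G.Adj y z ∧ ∀ u ∈ S, G.Adj y u → f u = f z → u = z

lemma card_nbr_add_card_le {B D : Finset κ} (hBD : Disjoint B D) {v : V}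
    (h : ∀ c ∈ D, ∃ u ∈ S, G.Adj v u ∧ f u = c) :
    #{u ∈ S | G.Adj v u ∧ f u ∈ B} + #D ≤ #{u ∈ S | G.Adj v u} := by
  have h1 : #D ≤ #{u ∈ S | G.Adj v u ∧ f u ∈ D} := by
    refine (card_le_card fun c hc => ?_).trans (card_image_le (f := f))
    obtain ⟨u, hu, huv, rfl⟩ := h c hc
    exact mem_image.2 ⟨u, by simp [hu, huv, hc], rfl⟩
  have h2 : Disjoint {u ∈ S | G.Adj v u ∧ f u ∈ B} {u ∈ S | G.Adj v u ∧ f u ∈ D} := by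
    rw [disjoint_filter]
    exact fun u _ hu hu' => disjoint_left.1 hBD hu.2 hu'.2
  calc _ ≤ _ := Nat.add_le_add_left h1 _
    _ = _ := (card_union_of_disjoint h2).symm
    _ ≤ _ := card_le_card fun u hu => by simp only [mem_union, mem_filter] at hu ⊢; tauto

lemma sum_sum_adj (G : SimpleGraph V) (P Q : Finset V) (w : V → ℕ) :
    ∑ y ∈ P, ∑ x ∈ Q with G.Adj y x, w x = ∑ x ∈ Q, #{y ∈ P | G.Adj x y} * w x := by
  simp only [sum_filter]
  rw [sum_comm]
  refine sum_congr rfl fun x _ => ?_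
  rw [← sum_filter, sum_const, smul_eq_mul]
  simp only [G.adj_comm]

section Counting

variable {A A' B : Finset κ} {s : ℕ}

lemma card_lt_card_of_solo {U : κ} (hAB : Disjoint A B) (hA' : A' ⊆ A) (hU : U ∈ A) (hUA' : U ∉ A')
    (hdeg : ∀ v ∈ S, #{u ∈ S | G.Adj v u} < #A + #B)
    (hB : ∀ y ∈ S, f y ∈ B → ∀ c ∈ A, ∃ u ∈ S, G.Adj y u ∧ f u = c)
    (hAA' : ∀ x ∈ S, f x ∈ A' → ∀ c ∈ A, c ≠ U → c ∉ A' → ∃ u ∈ S, G.Adj x u ∧ f u = c)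
    (hsolo : ∀ z y, Solo G S f A' B z y → ∀ c ∈ A, c ≠ f z → ∃ u ∈ S, G.Adj z u ∧ f u = c)
    (hs : ∀ c ∈ A', #{v ∈ S | f v = c} ≤ s) (hcard : #B * s < #{v ∈ S | f v ∈ B})
    (hne : A'.Nonempty) : #B < #A' := by
  obtain ⟨W, hW⟩ := hne
  by_contra! hlt
  let w : V → ℕ := fun x => if ∃ y, Solo G S f A' B x y then 2 else 1
  have hlow : ∀ y ∈ {v ∈ S | f v ∈ B}, 2 ≤ ∑ x ∈ {v ∈ S | f v = W} with G.Adj y x, w x := by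
    intro y hy
    rw [mem_filter] at hy
    obtain ⟨x, hx, hyx, hxW⟩ := hB y hy.1 hy.2 W (hA' hW)
    have hxm : x ∈ {x ∈ {v ∈ S | f v = W} | G.Adj y x} := by simp [hx, hyx, hxW]
    by_cases hall : ∀ u ∈ S, G.Adj y u → f u = W → u = x
    · have : w x = 2 := if_pos ⟨y, hx, hy.1, hxW ▸ hW, hy.2, hyx, hxW ▸ hall⟩
      exact this ▸ single_le_sum (f := w) (fun _ _ => Nat.zero_le _) hxm
    · push Not at hall
      obtain ⟨u, hu, hyu, huW, hux⟩ := hall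
      have hum : u ∈ {x ∈ {v ∈ S | f v = W} | G.Adj y x} := by simp [hu, hyu, huW]
      calc 2 ≤ #{x ∈ {v ∈ S | f v = W} | G.Adj y x} := one_lt_card.2 ⟨u, hum, x, hxm, hux⟩
        _ = ∑ x ∈ {v ∈ S | f v = W} with G.Adj y x, 1 := by simp
        _ ≤ _ := sum_le_sum fun x _ => by simp only [w]; split_ifs <;> simp
  have hup : ∀ x ∈ {v ∈ S | f v = W}, #{y ∈ {v ∈ S | f v ∈ B} | G.Adj x y} * w x ≤ 2 * #B := by
    intro x hx
    rw [mem_filter] at hx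
    have hfil : #{y ∈ {v ∈ S | f v ∈ B} | G.Adj x y} = #{u ∈ S | G.Adj x u ∧ f u ∈ B} := by
      rw [filter_filter]; simp only [and_comm]
    have hd := hdeg x hx.1
    rw [hfil]
    by_cases hsx : ∃ y, Solo G S f A' B x y
    · obtain ⟨y, hy⟩ := hsx
      have h1 := card_nbr_add_card_le (v := x) (f := f) (G := G) (S := S)
        (hAB.symm.mono_right (erase_subset W A)) fun c hc =>
          hsolo x y hy c (mem_of_mem_erase hc) (hx.2 ▸ ne_of_mem_erase hc)
      have h2 := card_erase_add_one (hA' hW)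
      have h3 : w x = 2 := if_pos ⟨y, hy⟩
      rw [h3]
      omega
    · have h1 := card_nbr_add_card_le (v := x) (f := f) (G := G) (S := S) (D := (A \ A').erase U)
        (hAB.symm.mono_right ((erase_subset _ _).trans sdiff_subset)) fun c hc => by
          simp only [mem_erase, mem_sdiff] at hc
          exact hAA' x hx.1 (hx.2 ▸ hW) c hc.2.1 hc.1 hc.2.2
      have h2 := card_erase_add_one (mem_sdiff.2 ⟨hU, hUA'⟩)
      have h3 := card_sdiff_add_card_eq_card hA'
      have h4 : w x = 1 := if_neg hsx
      rw [h4]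
      omega
  have h1 := card_nsmul_le_sum _ _ _ hlow
  rw [sum_sum_adj] at h1
  have h2 := h1.trans (sum_le_card_nsmul _ _ _ hup)
  have h3 := Nat.mul_le_mul_right (2 * #B) (hs W hW)
  simp only [smul_eq_mul] at h2
  nlinarith

lemma card_add_le_card_solo (hAB : Disjoint A B) (hA' : A' ⊆ A)
    (hdeg : ∀ v ∈ S, #{u ∈ S | G.Adj v u} < #A + #B)
    (hB : ∀ y ∈ S, f y ∈ B → ∀ c ∈ A, ∃ u ∈ S, G.Adj y u ∧ f u = c)
    {y : V} (hy : y ∈ S) (hyB : f y ∈ B) :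
    #A' + #{u ∈ S | G.Adj y u ∧ f u ∈ B} + 1 ≤ #B + #{z ∈ S | Solo G S f A' B z y} := by
  have h1 : #{u ∈ S | G.Adj y u ∧ f u ∈ A} =
      ∑ c ∈ A, #{u ∈ {u ∈ S | G.Adj y u ∧ f u ∈ A} | f u = c} :=
    card_eq_sum_card_fiberwise fun u hu => by
      rw [mem_coe, mem_filter] at hu; exact hu.2.2
  have h2 : ∑ c ∈ A, (1 + if c ∈ A' \ image f {z ∈ S | Solo G S f A' B z y} then 1 else 0) ≤
      ∑ c ∈ A, #{u ∈ {u ∈ S | G.Adj y u ∧ f u ∈ A} | f u = c} := by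
    refine sum_le_sum fun c hc => ?_
    obtain ⟨x, hx, hyx, hxc⟩ := hB y hy hyB c hc
    have hxm : x ∈ {u ∈ {u ∈ S | G.Adj y u ∧ f u ∈ A} | f u = c} := by simp [hx, hyx, hxc, hc]
    split_ifs with hcs
    · rw [mem_sdiff] at hcs
      by_contra! hlt
      refine hcs.2 (mem_image.2 ⟨x, mem_filter.2 ⟨hx, hx, hy, hxc ▸ hcs.1, hyB, hyx, ?_⟩, hxc⟩)
      intro u hu hyu hux
      exact card_le_one.1 (Nat.lt_succ_iff.1 hlt) u (by simp [hu, hyu, hux, hxc, hc]) x hxm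
    · exact card_pos.2 ⟨x, hxm⟩
  rw [sum_add_distrib, ← card_filter, sum_const, smul_eq_mul, mul_one] at h2
  have h3 : {c ∈ A | c ∈ A' \ image f {z ∈ S | Solo G S f A' B z y}} =
      A' \ image f {z ∈ S | Solo G S f A' B z y} := by
    ext c
    simp only [mem_filter, mem_sdiff]
    exact ⟨fun h => h.2, fun h => ⟨hA' h.1, h⟩⟩
  rw [h3] at h2
  have h4 := le_card_sdiff (image f {z ∈ S | Solo G S f A' B z y}) A'
  have h5 := card_image_le (s := {z ∈ S | Solo G S f A' B z y}) (f := f)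
  have h6 : Disjoint {u ∈ S | G.Adj y u ∧ f u ∈ B} {u ∈ S | G.Adj y u ∧ f u ∈ A} := by
    rw [disjoint_filter]
    exact fun u _ hu hu' => disjoint_left.1 hAB hu'.2 hu.2
  have h7 : #({u ∈ S | G.Adj y u ∧ f u ∈ B} ∪ {u ∈ S | G.Adj y u ∧ f u ∈ A}) ≤
      #{u ∈ S | G.Adj y u} :=
    card_le_card fun u hu => by simp only [mem_union, mem_filter] at hu ⊢; tauto
  rw [card_union_of_disjoint h6] at h7
  have h8 := hdeg y hy
  omega

lemma exists_solo_not_adj (hAB : Disjoint A B) (hA' : A' ⊆ A)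
    (hdeg : ∀ v ∈ S, #{u ∈ S | G.Adj v u} < #A + #B)
    (hB : ∀ y ∈ S, f y ∈ B → ∀ c ∈ A, ∃ u ∈ S, G.Adj y u ∧ f u = c)
    (hs : ∀ c ∈ A', #{v ∈ S | f v = c} ≤ s) (hcard : #B * s < #{v ∈ S | f v ∈ B})
    (hlt : #B < #A') :
    ∃ z y₁ y₂, Solo G S f A' B z y₁ ∧ Solo G S f A' B z y₂ ∧ y₁ ≠ y₂ ∧ ¬ G.Adj y₁ y₂ := by
  by_contra! hadj
  let k : V → ℕ := fun z => #{y ∈ {v ∈ S | f v ∈ B} | Solo G S f A' B z y}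
  have hup : ∑ z ∈ S with f z ∈ A', ∑ y ∈ {v ∈ S | f v ∈ B} with Solo G S f A' B z y,
      (1 / k z : ℚ) ≤ #A' * s := by
    have hz : ∀ z ∈ {z ∈ S | f z ∈ A'},
        ∑ y ∈ {v ∈ S | f v ∈ B} with Solo G S f A' B z y, (1 / k z : ℚ) ≤ 1 := by
      intro z _
      rw [sum_const, nsmul_eq_mul, mul_one_div]
      exact div_self_le_one _
    refine (sum_le_card_nsmul _ _ _ hz).trans ?_
    rw [nsmul_eq_mul, mul_one]
    have h1 : #{z ∈ S | f z ∈ A'} ≤ #A' * s := by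
      rw [card_eq_sum_card_fiberwise (f := f) (t := A') fun u hu => by
        rw [mem_coe, mem_filter] at hu; exact hu.2]
      refine (sum_le_card_nsmul _ _ s fun c hc => ?_)
      refine (card_le_card fun u hu => ?_).trans (hs c hc)
      simp only [mem_filter] at hu ⊢
      exact ⟨hu.1.1, hu.2⟩
    exact_mod_cast h1
  have hlow : ∀ y ∈ {v ∈ S | f v ∈ B}, (#A' / #B : ℚ) ≤
      ∑ z ∈ {z ∈ S | f z ∈ A'} with Solo G S f A' B z y, (1 / k z : ℚ) := by
    intro y hy
    rw [mem_filter] at hy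
    set d := #{u ∈ S | G.Adj y u ∧ f u ∈ B}
    have hk : ∀ z ∈ {z ∈ {z ∈ S | f z ∈ A'} | Solo G S f A' B z y},
        (1 / (d + 1) : ℚ) ≤ 1 / k z := by
      intro z hz
      have hzy := (mem_filter.1 hz).2
      have hpos : 0 < k z := card_pos.2 ⟨y, by simp [hy, hzy]⟩
      have hle : k z ≤ d + 1 := by
        refine (card_le_card (t := insert y {u ∈ S | G.Adj y u ∧ f u ∈ B}) fun u hu => ?_).trans
          (card_insert_le _ _)
        simp only [mem_filter, mem_insert] at hu ⊢
        by_cases huy : u = y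
        · exact Or.inl huy
        · exact Or.inr ⟨hu.1.1, hadj z y u hzy hu.2 (Ne.symm huy), hu.1.2⟩
      exact one_div_le_one_div_of_le (by exact_mod_cast hpos) (by exact_mod_cast hle)
    refine le_trans ?_ (card_nsmul_le_sum _ _ _ hk)
    have h1 := card_add_le_card_solo hAB hA' hdeg hB hy.1 hy.2
    have h2 : {z ∈ {z ∈ S | f z ∈ A'} | Solo G S f A' B z y} = {z ∈ S | Solo G S f A' B z y} := by
      ext z
      simp only [mem_filter]
      exact ⟨fun h => ⟨h.1.1, h.2⟩, fun h => ⟨⟨h.1, h.2.2.2.1⟩, h.2⟩⟩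
    have h3 : d + #A ≤ _ := card_nbr_add_card_le (v := y) (f := f) (G := G) (S := S) hAB.symm
      (hB y hy.1 hy.2)
    have h4 := hdeg y hy.1
    have h5 : d + 1 ≤ #B := by omega
    have hBpos : (0 : ℚ) < #B := by exact_mod_cast (by omega : 0 < #B)
    rw [h2, nsmul_eq_mul, mul_one_div, div_le_div_iff₀ hBpos (by positivity)]
    have h1' : (#A' + d + 1 : ℚ) ≤ #B + #{z ∈ S | Solo G S f A' B z y} := by exact_mod_cast h1
    have h5' : (d + 1 : ℚ) ≤ #B := by exact_mod_cast h5
    have h6' : (#B : ℚ) ≤ #A' := by exact_mod_cast hlt.le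
    nlinarith [mul_nonneg (sub_nonneg.2 h5') (sub_nonneg.2 h6')]
  have htot := card_nsmul_le_sum _ _ _ hlow
  have hswap : ∑ y ∈ S with f y ∈ B, ∑ z ∈ {z ∈ S | f z ∈ A'} with Solo G S f A' B z y,
      (1 / k z : ℚ) = ∑ z ∈ S with f z ∈ A', ∑ y ∈ {v ∈ S | f v ∈ B} with Solo G S f A' B z y,
      (1 / k z : ℚ) := by
    simp only [sum_filter (p := fun y => Solo G S f A' B _ y),
      sum_filter (p := fun z => Solo G S f A' B z _)]
    exact sum_comm
  rw [hswap] at htot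
  have h1 := htot.trans hup
  rw [nsmul_eq_mul] at h1
  have hne : 0 < #B := by
    obtain ⟨y, hy⟩ := card_pos.1 (Nat.zero_lt_of_lt hcard)
    exact card_pos.2 ⟨f y, (mem_filter.1 hy).2⟩
  have hBpos : (0 : ℚ) < #B := by exact_mod_cast hne
  have hApos : (0 : ℚ) < #A' := by exact_mod_cast hne.trans hlt
  rw [mul_div_assoc', div_le_iff₀ hBpos] at h1
  have h2 : (#B * s : ℚ) < #{v ∈ S | f v ∈ B} := by exact_mod_cast hcard
  nlinarith [mul_lt_mul_of_pos_right h2 hApos]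

end Counting

/-- `f` is a proper colouring of `G` on `S` with colours in `C`, all classes having size `s`. -/
def Equitable (G : SimpleGraph V) (S : Finset V) (C : Finset κ) (s : ℕ) (f : V → κ) : Prop :=
  (∀ v ∈ S, f v ∈ C) ∧ ProperOn G S f ∧ ∀ c ∈ C, #{v ∈ S | f v = c} = s

lemma Reach.eq_or_mem {D : Finset κ} {a b : κ} (h : Reach G S f D a b) : a = b ∨ b ∈ D := by
  rcases ReflTransGen.cases_tail h with h | ⟨c, _, hc⟩
  · exact Or.inl h.symm
  · exact Or.inr hc.2.1

lemma Reach.restrict {D : Finset κ} {a b : κ} (h : Reach G S f D a b) :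
    Reach G S f {c ∈ D | Reach G S f D c b} a b := by
  induction h using ReflTransGen.head_induction_on with
  | refl => exact ReflTransGen.refl
  | @head x x' hs ht ih =>
    exact ReflTransGen.head ⟨mem_filter.2 ⟨hs.1, ReflTransGen.head hs ht⟩,
      mem_filter.2 ⟨hs.2.1, ht⟩, hs.2.2⟩ ih

/-- A set `A'` of classes with the end vertex `b` reachable from everywhere after deleting any
one of them, and such that classes in `A'` only have steps to `A'` and one other class `U`. -/
lemma exists_terminal {A : Finset κ} {b : κ} (hb : b ∈ A) (hA : ∀ c ∈ A, Reach G S f A c b)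
    (hne : ∃ c ∈ A, c ≠ b) :
    ∃ A' ⊆ A, ∃ U ∈ A, A'.Nonempty ∧ b ∉ A' ∧ U ∉ A' ∧
      (∀ W ∈ A', ∀ X ∈ A, X ≠ W → Reach G S f (A.erase W) X b) ∧
      ∀ W ∈ A', ∀ X ∈ A, X ≠ U → X ∉ A' → ¬ Step G S f A W X := by
  let T : κ → Finset κ := fun U => {c ∈ A | c ≠ U ∧ ¬ Reach G S f (A.erase U) c b}
  have hT : ∀ {U c}, c ∈ T U ↔ c ∈ A ∧ c ≠ U ∧ ¬ Reach G S f (A.erase U) c b := by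
    intro U c; simp only [T, mem_filter]
  have hbT : ∀ U, b ∉ T U := fun U h => (hT.1 h).2.2 ReflTransGen.refl
  have hex : ({U ∈ A | (T U).Nonempty}).Nonempty := by
    obtain ⟨c, hc, hcb⟩ := hne
    refine ⟨b, mem_filter.2 ⟨hb, c, hT.2 ⟨hc, hcb, fun h => ?_⟩⟩⟩
    rcases h.eq_or_mem with h | h
    · exact hcb h
    · exact notMem_erase _ _ h
  obtain ⟨U, hU, hmin⟩ := exists_min_image _ (fun U => #(T U)) hex
  rw [mem_filter] at hU
  refine ⟨T U, filter_subset _ _, U, hU.1, hU.2, hbT U, fun h => (hT.1 h).2.1 rfl, ?_, ?_⟩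
  · intro W hW
    have hWU := hT.1 hW
    by_contra! hX
    obtain ⟨X, hXA, hXW, hXr⟩ := hX
    have hsub : T W ⊆ T U := by
      intro Y hY
      have hYW := hT.1 hY
      by_contra hYU
      apply hYW.2.2
      by_cases hYe : Y = U
      · subst hYe
        rcases (hA Y hU.1).cases_head_erase with rfl | ⟨c, hcY, hs, hr⟩
        · exact ReflTransGen.refl
        · have hcW : c ≠ W := by rintro rfl; exact hWU.2.2 hr
          exact ReflTransGen.head ⟨mem_erase.2 ⟨hYW.2.1, hs.1⟩, mem_erase.2 ⟨hcW, hs.2.1⟩, hs.2.2⟩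
            (hr.erase_of_not hWU.2.2)
      · have hr : Reach G S f (A.erase U) Y b := by
          by_contra hr
          exact hYU (hT.2 ⟨hYW.1, hYe, hr⟩)
        exact hr.erase_of_not hWU.2.2
    have hss : T W ⊂ T U :=
      (ssubset_iff_of_subset hsub).2 ⟨W, hW, fun h => (hT.1 h).2.1 rfl⟩
    exact (card_lt_card hss).not_ge
      (hmin W (mem_filter.2 ⟨hWU.1, X, hT.2 ⟨hXA, hXW, hXr⟩⟩))
  · intro W hW X hXA hXU hXT hs
    have hWU := hT.1 hW
    have hr : Reach G S f (A.erase U) X b := by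
      by_contra hr
      exact hXT (hT.2 ⟨hXA, hXU, hr⟩)
    exact hWU.2.2 (ReflTransGen.head
      ⟨mem_erase.2 ⟨hWU.2.1, hWU.1⟩, mem_erase.2 ⟨hXU, hXA⟩, hs.2.2⟩ hr)

/-- If all classes have size `s`, except that the class of `lo` misses a vertex and that of `hi`
has one too many, then the colouring can be made equitable. -/
lemma exists_equitable_of_near {C : Finset κ} {s : ℕ}
    (IH : ∀ C' : Finset κ, #C' < #C → ∀ S' : Finset V, #S' = #C' * s →
      (∀ v ∈ S', #{u ∈ S' | G.Adj v u} < #C') → ∃ g, Equitable G S' C' s g)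
    (hdeg : ∀ v ∈ S, #{u ∈ S | G.Adj v u} < #C) {lo hi : κ} (hlo : lo ∈ C) (hhi : hi ∈ C)
    (hfC : ∀ v ∈ S, f v ∈ C) (hf : ProperOn G S f)
    (hnear : ∀ c ∈ C, #{v ∈ S | f v = c} + (if c = lo then 1 else 0) =
      s + (if c = hi then 1 else 0)) :
    ∃ g, Equitable G S C s g := by
  induction hN : #(C \ {c ∈ C | Reach G S f C c lo}) using Nat.strong_induction_on
    generalizing f hi with
  | _ N ihN =>
  set A := {c ∈ C | Reach G S f C c lo}
  set B := C \ A
  have hAC : A ⊆ C := filter_subset _ _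
  have hloA : lo ∈ A := mem_filter.2 ⟨hlo, ReflTransGen.refl⟩
  have hAB : Disjoint A B := disjoint_sdiff
  have hcardC : #A + #B = #C := by
    rw [add_comm]; exact card_sdiff_add_card_eq_card hAC
  have hmemC : ∀ {c}, c ∈ C → c ∉ A → c ∈ B := fun h h' => mem_sdiff.2 ⟨h, h'⟩
  have hnotB : ∀ {c}, c ∈ A → c ∉ B := fun h h' => disjoint_left.1 hAB h h'
  have hnotA : ∀ {c}, c ∈ B → c ∉ A := fun h h' => disjoint_left.1 hAB h' h
  by_cases hhiA : hi ∈ A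
  · obtain ⟨f', hp, _, hin, _, hc⟩ := (mem_filter.1 hhiA).2.exists_shift hf
    refine ⟨f', fun v hv => hin v (hfC v hv), hp, fun c hcC => ?_⟩
    have h1 := hc c
    have h2 := hnear c hcC
    omega
  have hhiB : hi ∈ B := hmemC hhi hhiA
  have hB : ∀ y ∈ S, f y ∈ B → ∀ c ∈ A, ∃ u ∈ S, G.Adj y u ∧ f u = c := by
    intro y hy hyB c hc
    by_contra! hcon
    exact hnotA hyB (mem_filter.2 ⟨hfC y hy, ReflTransGen.head
      ⟨hfC y hy, hAC hc, y, hy, rfl, hcon⟩ (mem_filter.1 hc).2⟩)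
  have hdeg' : ∀ v ∈ S, #{u ∈ S | G.Adj v u} < #A + #B := fun v hv => hcardC ▸ hdeg v hv
  have hdegB : ∀ y ∈ S, f y ∈ B → #{u ∈ S | G.Adj y u ∧ f u ∈ B} < #B := by
    intro y hy hyB
    have h1 := card_nbr_add_card_le hAB.symm (hB y hy hyB)
    have h2 := hdeg' y hy
    omega
  have hsA : ∀ c ∈ A, #{v ∈ S | f v = c} + (if c = lo then 1 else 0) = s := by
    intro c hc
    rw [hnear c (hAC hc), if_neg (fun h : c = hi => hhiA (h ▸ hc)), add_zero]
  have hsB : #{v ∈ S | f v ∈ B} = #B * s + 1 := by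
    rw [card_eq_sum_card_fiberwise (f := f) (t := B) fun u hu => by
      rw [mem_coe, mem_filter] at hu; exact hu.2]
    have : ∀ c ∈ B, #{v ∈ {v ∈ S | f v ∈ B} | f v = c} = s + (if c = hi then 1 else 0) := by
      intro c hc
      rw [← hnear c (sdiff_subset hc), if_neg (fun h : c = lo => hnotA hc (h ▸ hloA)), add_zero,
        filter_filter]
      congr 1
      ext v
      simp only [mem_filter]
      exact ⟨fun h => ⟨h.1, h.2.2⟩, fun h => ⟨h.1, h.2 ▸ hc, h.2⟩⟩
    rw [sum_congr rfl this, sum_add_distrib, sum_const, smul_eq_mul, sum_ite_eq' , if_pos hhiB]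
  have hrec : ∀ y ∈ S, f y ∈ B → ∃ g, Equitable G ({v ∈ S | f v ∈ B}.erase y) B s g := by
    intro y hy hyB
    have hyS : y ∈ {v ∈ S | f v ∈ B} := mem_filter.2 ⟨hy, hyB⟩
    refine IH B ?_ _ (by rw [card_erase_of_mem hyS, hsB]; rfl) fun v hv => ?_
    · have := card_pos.2 ⟨lo, hloA⟩
      omega
    · have hv' := mem_filter.1 (mem_of_mem_erase hv)
      refine lt_of_le_of_lt (card_le_card fun u hu => ?_) (hdegB v hv'.1 hv'.2)
      simp only [mem_filter, mem_erase] at hu ⊢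
      tauto
  have hne : ∃ c ∈ A, c ≠ lo := by
    by_contra! hall
    have hA1 : #A = 1 := card_eq_one.2 ⟨lo, eq_singleton_iff_unique_mem.2 ⟨hloA, hall⟩⟩
    have hlow : ∀ y ∈ {v ∈ S | f v ∈ B}, 1 ≤ ∑ x ∈ {v ∈ S | f v = lo} with G.Adj y x, 1 := by
      intro y hy
      rw [mem_filter] at hy
      obtain ⟨x, hx, hyx, hxl⟩ := hB y hy.1 hy.2 lo hloA
      rw [sum_const, smul_eq_mul, mul_one]
      exact card_pos.2 ⟨x, by simp [hx, hyx, hxl]⟩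
    have h1 := card_nsmul_le_sum _ _ _ hlow
    rw [sum_sum_adj] at h1
    have h2 := h1.trans (sum_le_card_nsmul _ _ #B fun x hx => by
      have hx := mem_filter.1 hx
      have h3 := hdeg' x hx.1
      have h4 : #{y ∈ {v ∈ S | f v ∈ B} | G.Adj x y} ≤ #{u ∈ S | G.Adj x u} :=
        card_le_card fun u hu => by simp only [mem_filter] at hu ⊢; tauto
      omega)
    have h5 := hsA lo hloA
    rw [if_pos rfl] at h5
    rw [hsB, smul_eq_mul, smul_eq_mul, mul_one, ← h5] at h2
    nlinarith
  obtain ⟨A', hA', U, hU, hA'ne, hloA', hUA', hterm, hstep⟩ :=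
    exists_terminal hloA (fun c hc => (mem_filter.1 hc).2.restrict) hne
  have hout : ∀ {y : V} {f₁ : V → κ}, (∀ v ∈ S, f v ∈ A → f₁ v ∈ A) → f₁ y ∈ A →
      ∀ v ∈ S, v ∉ {v ∈ S | f v ∈ B}.erase y → f₁ v ∉ B := by
    intro y f₁ h1 h2 v hv hvB
    by_cases hvy : v = y
    · exact hvy ▸ hnotB h2
    · refine hnotB (h1 v hv ?_)
      by_contra hvA
      exact hvB (mem_erase.2 ⟨hvy, mem_filter.2 ⟨hv, hmemC (hfC v hv) hvA⟩⟩)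
  by_cases hmove : ∃ z y, Solo G S f A' B z y ∧ ∃ X ∈ A, X ≠ f z ∧ Movable G S f z X
  · obtain ⟨z, y, ⟨hz, hy, hzA', hyB, -, huniq⟩, X, hX, hXz, hzX⟩ := hmove
    obtain ⟨g, hgB, hgp, hgs⟩ := hrec y hy hyB
    obtain ⟨f', hp, hfix, hin, hsub, hc⟩ := (hterm _ hzA' X hX hXz).exists_shift hf
    have hzA := hA' hzA'
    have hzf : f' z = f z := hfix z (notMem_erase _ _)
    have hBf : ∀ v, f v ∈ B → f' v = f v := fun v hv =>
      hfix v fun h => hnotA hv (mem_of_mem_erase h)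
    have hyz : y ≠ z := by rintro rfl; exact hnotA hyB hzA
    set f₁ := update f' z X with hf₁
    set f₂ := update f₁ y (f z) with hf₂
    have hp₁ : ProperOn G S f₁ := (hp.mono (erase_subset _ _)).update
      fun u hu hzu h => hzX u hu hzu (hsub u h)
    have hWsub : ∀ v, f' v = f z → f v = f z := by
      intro v hv
      by_contra hvz
      by_cases hvA : f v ∈ A
      · exact ne_of_mem_erase (hin v (mem_erase.2 ⟨hvz, hvA⟩)) hv
      · exact hvz (hfix v (fun h => hvA (mem_of_mem_erase h)) ▸ hv)
    have hp₂ : ProperOn G S f₂ := (hp₁.mono (erase_subset _ _)).update fun u hu hyu h => by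
      by_cases huz : u = z
      · subst huz
        rw [hf₁, update_self] at h
        exact hXz h
      · rw [hf₁, update_of_ne huz] at h
        exact huz (huniq u hu hyu (hWsub u h))
    have hf'A : ∀ v, f v ∈ A → f' v ∈ A := by
      intro v hv
      by_cases hvz : f v = f z
      · rw [hfix v (by simp [hvz])]; exact hv
      · exact mem_of_mem_erase (hin v (mem_erase.2 ⟨hvz, hv⟩))
    have hf₂A : ∀ v ∈ S, f v ∈ A → f₂ v ∈ A := by
      intro v _ hv
      have hvy : v ≠ y := by rintro rfl; exact hnotA hyB hv
      rw [hf₂, update_of_ne hvy]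
      by_cases hvz : v = z
      · subst hvz; rw [hf₁, update_self]; exact hX
      · rw [hf₁, update_of_ne hvz]; exact hf'A v hv
    have hf₂y : f₂ y ∈ A := by rw [hf₂, update_self]; exact hzA
    have hf₂B : ∀ v ∈ {v ∈ S | f v ∈ B}.erase y, f₂ v ∈ B := by
      intro v hv
      simp only [mem_erase, mem_filter] at hv
      have hvz : v ≠ z := by rintro rfl; exact hnotB hzA hv.2.2
      rw [hf₂, update_of_ne hv.1, hf₁, update_of_ne hvz, hBf v hv.2.2]
      exact hv.2.2
    refine ⟨_, ?_, hp₂.piecewise hgp hgB (hout hf₂A hf₂y), fun c hcC => ?_⟩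
    · intro v hv
      split_ifs with h
      · exact sdiff_subset (hgB v h)
      · by_cases hvy : v = y
        · exact hAC (hvy ▸ hf₂y)
        · refine hAC (hf₂A v hv ?_)
          by_contra hvA
          exact h (mem_erase.2 ⟨hvy, mem_filter.2 ⟨hv, hmemC (hfC v hv) hvA⟩⟩)
    · by_cases hcA : c ∈ A
      · rw [card_piecewise_of_notMem hgB hf₂B (hnotB hcA)]
        have h1 : #{v ∈ S | f₂ v = c} + _ = _ := card_update hy (f z) c
        have h2 : #{v ∈ S | f₁ v = c} + _ = _ := card_update hz X c
        have h3 := hc c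
        have h4 := hsA c hcA
        have h5 : c ≠ f₁ y := by
          rw [hf₁, update_of_ne hyz, hBf y hyB]
          rintro rfl
          exact hnotA hyB hcA
        rw [if_neg h5] at h1
        rw [hzf] at h2
        omega
      · rw [card_piecewise_of_mem ((erase_subset _ _).trans (filter_subset _ _))
          (hout hf₂A hf₂y) (hmemC hcC hcA)]
        exact hgs c (hmemC hcC hcA)
  · have hsolo : ∀ z y, Solo G S f A' B z y → ∀ c ∈ A, c ≠ f z →
        ∃ u ∈ S, G.Adj z u ∧ f u = c := by
      intro z y hzy c hc hcz
      by_contra! hcon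
      exact hmove ⟨z, y, hzy, c, hc, hcz, hcon⟩
    have hs : ∀ c ∈ A', #{v ∈ S | f v = c} ≤ s := fun c hc => by
      have := hsA c (hA' hc); omega
    have hcardB : #B * s < #{v ∈ S | f v ∈ B} := by omega
    have hlt := card_lt_card_of_solo hAB hA' hU hUA' hdeg' hB (fun x hx hxA' c hc hcU hcA' => by
      by_contra! hcon
      exact hstep _ hxA' c hc hcU hcA' ⟨hA' hxA', hc, x, hx, rfl, hcon⟩) hsolo hs hcardB hA'ne
    obtain ⟨z, y, y₂, hzy, hzy₂, hyy₂, hnadj⟩ :=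
      exists_solo_not_adj hAB hA' hdeg' hB hs hcardB hlt
    have hzsolo := hsolo z y hzy
    obtain ⟨hz, hy, hzA', hyB, hyz, huniq⟩ := hzy
    obtain ⟨-, hy₂, -, hy₂B, hy₂z, huniq₂⟩ := hzy₂
    have hzA := hA' hzA'
    obtain ⟨g, hgB, hgp, hgs⟩ := hrec y hy hyB
    set B' := {v ∈ S | f v ∈ B}.erase y with hB'
    have hzB' : z ∉ B' := fun h => hnotB hzA (mem_filter.1 (mem_of_mem_erase h)).2
    obtain ⟨c₀, hc₀, hzc₀⟩ : ∃ c ∈ B, ∀ u ∈ B', G.Adj z u → g u ≠ c := by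
      by_contra! hcon
      have h1 : #B ≤ #{u ∈ B' | G.Adj z u} := by
        refine (card_le_card fun c hc => ?_).trans (card_image_le (f := g))
        obtain ⟨u, hu, hzu, hgu⟩ := hcon c hc
        exact mem_image.2 ⟨u, mem_filter.2 ⟨hu, hzu⟩, hgu⟩
      have h2 : insert y {u ∈ B' | G.Adj z u} ⊆ {u ∈ S | G.Adj z u ∧ f u ∈ B} := by
        intro u hu
        simp only [mem_insert, mem_filter, hB', mem_erase] at hu ⊢
        rcases hu with rfl | hu
        · exact ⟨hy, hyz.symm, hyB⟩
        · exact ⟨hu.1.2.1, hu.2, hu.1.2.2⟩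
      have h3 := card_le_card h2
      rw [card_insert_of_notMem (by simp [hB'])] at h3
      have h4 := card_nbr_add_card_le (v := z) (f := f) (G := G) (S := S)
        (hAB.symm.mono_right (erase_subset (f z) A)) fun c hc =>
          hzsolo c (mem_of_mem_erase hc) (ne_of_mem_erase hc)
      have h5 := card_erase_add_one hzA
      have h6 := hdeg' z hz
      omega
    set f₁ := update f y (f z) with hf₁
    have hyz' : z ≠ y := hyz.ne'
    have hp₁ : ProperOn G (S.erase z) f₁ :=
      (hf.mono ((erase_subset _ _).trans (erase_subset _ _))).update fun u hu hyu h =>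
        ne_of_mem_erase hu (huniq u (mem_of_mem_erase hu) hyu h)
    have hf₁A : ∀ v ∈ S, f v ∈ A → f₁ v ∈ A := by
      intro v _ hv
      have hvy : v ≠ y := by rintro rfl; exact hnotA hyB hv
      rw [hf₁, update_of_ne hvy]; exact hv
    have hf₁y : f₁ y ∈ A := by rw [hf₁, update_self]; exact hzA
    have hf₁B : ∀ v ∈ B', f₁ v ∈ B := by
      intro v hv
      simp only [hB', mem_erase, mem_filter] at hv
      rw [hf₁, update_of_ne hv.1]
      exact hv.2.2
    have hf₁out : ∀ v ∈ S, v ∉ B' → f₁ v ∉ B := hout hf₁A hf₁y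
    set h₁ : V → κ := fun v => if v ∈ B' then g v else f₁ v with hh₁
    have hph₁ : ProperOn G (S.erase z) h₁ := hp₁.piecewise hgp hgB
      fun v hv => hf₁out v (mem_of_mem_erase hv)
    have hh₁z : h₁ z = f z := by simp only [hh₁, if_neg hzB', hf₁, update_of_ne hyz']
    set h := update h₁ z c₀ with hh
    have hph : ProperOn G S h := hph₁.update fun u hu hzu hc => by
      by_cases huB : u ∈ B'
      · simp only [hh₁, if_pos huB] at hc
        exact hzc₀ u huB hzu hc
      · simp only [hh₁, if_neg huB] at hc
        exact hf₁out u hu huB (hc ▸ hc₀)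
    have hhC : ∀ v ∈ S, h v ∈ C := by
      intro v hv
      by_cases hvz : v = z
      · subst hvz; rw [hh, update_self]; exact sdiff_subset hc₀
      · rw [hh, update_of_ne hvz]
        by_cases hvB : v ∈ B'
        · simp only [hh₁, if_pos hvB]; exact sdiff_subset (hgB v hvB)
        · simp only [hh₁, if_neg hvB, hf₁]
          by_cases hvy : v = y
          · subst hvy; rw [update_self]; exact hAC hzA
          · rw [update_of_ne hvy]; exact hfC v hv
    have hhnear : ∀ c ∈ C, #{v ∈ S | h v = c} + (if c = lo then 1 else 0) =
        s + (if c = c₀ then 1 else 0) := by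
      intro c hcC
      have h1 : #{v ∈ S | h v = c} + _ = _ := card_update hz c₀ c
      rw [hh₁z] at h1
      by_cases hcA : c ∈ A
      · have h2 : #{v ∈ S | h₁ v = c} = _ := card_piecewise_of_notMem hgB hf₁B (hnotB hcA)
        have h3 : #{v ∈ S | f₁ v = c} + _ = _ := card_update hy (f z) c
        have h4 := hsA c hcA
        rw [if_neg (fun e : c = f y => hnotA hyB (e ▸ hcA))] at h3
        omega
      · have h2 : #{v ∈ S | h₁ v = c} = _ := card_piecewise_of_mem
          ((erase_subset _ _).trans (filter_subset _ _)) hf₁out (hmemC hcC hcA)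
        rw [hgs c (hmemC hcC hcA)] at h2
        rw [if_neg (fun e : c = f z => hcA (e ▸ hzA))] at h1
        rw [if_neg (fun e : c = lo => hcA (e ▸ hloA))]
        omega
    -- outside the class of `z`, the classes with colours in `A` are unchanged
    have hsame : ∀ v ∈ S, ∀ c ∈ A.erase (f z), h v = c ↔ f v = c := by
      intro v hv c hc
      rw [mem_erase] at hc
      by_cases hvz : v = z
      · subst hvz
        rw [hh, update_self]
        exact ⟨fun e => absurd (e ▸ hc₀) (hnotB hc.2), fun e => absurd e.symm hc.1⟩
      rw [hh, update_of_ne hvz]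
      by_cases hvB : v ∈ B'
      · simp only [hh₁, if_pos hvB]
        have h1 := (mem_filter.1 (mem_of_mem_erase hvB)).2
        exact ⟨fun e => absurd (e ▸ hgB v hvB) (hnotB hc.2), fun e => absurd (e ▸ h1) (hnotB hc.2)⟩
      · simp only [hh₁, if_neg hvB, hf₁]
        by_cases hvy : v = y
        · subst hvy
          rw [update_self]
          exact ⟨fun e => absurd e.symm hc.1, fun e => absurd (e ▸ hyB) (hnotB hc.2)⟩
        · rw [update_of_ne hvy]
    have hreach : ∀ X ∈ A, X ≠ f z → Reach G S h C X lo := by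
      intro X hX hXz
      refine ReflTransGen.mono (r := Step G S f (A.erase (f z))) ?_ _ _ (hterm _ hzA' X hX hXz)
      rintro a b ⟨ha, hb, w, hw, hwa, hwb⟩
      exact ⟨hAC (mem_of_mem_erase ha), hAC (mem_of_mem_erase hb), w, hw, (hsame w hw a ha).2 hwa,
        fun u hu hwu e => hwb u hu hwu ((hsame u hu b hb).1 e)⟩
    have hreachz : Reach G S h C (f z) lo := by
      rcases ((mem_filter.1 hzA).2.restrict).cases_head_erase with e | ⟨X, hXz, hs, -⟩
      · exact absurd (e ▸ hzA') hloA'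
      · obtain ⟨-, hX, w, hw, hwz, hwX⟩ := hs
        have hne : w ≠ z := by
          rintro rfl
          obtain ⟨u, hu, hzu, huX⟩ := hzsolo X hX hXz
          exact hwX u hu hzu huX
        have hwB : w ∉ B' := fun h' => hnotB hzA (hwz ▸ (mem_filter.1 (mem_of_mem_erase h')).2)
        have hwy : w ≠ y := by rintro rfl; exact hnotB hzA (hwz ▸ hyB)
        refine ReflTransGen.head ⟨hAC hzA, hAC hX, w, hw, ?_, fun u hu hwu e =>
          hwX u hu hwu ((hsame u hu X (mem_erase.2 ⟨hXz, hX⟩)).1 e)⟩ (hreach X hX hXz)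
        rw [hh, update_of_ne hne]
        simp only [hh₁, if_neg hwB, hf₁, update_of_ne hwy, hwz]
    have hy₂B' : y₂ ∈ B' := mem_erase.2 ⟨hyy₂.symm, mem_filter.2 ⟨hy₂, hy₂B⟩⟩
    have hhy₂ : h y₂ = g y₂ := by
      rw [hh, update_of_ne hy₂z.ne]
      simp only [hh₁, if_pos hy₂B']
    have hgy₂ := hgB y₂ hy₂B'
    have hreachy₂ : Reach G S h C (g y₂) lo := by
      refine ReflTransGen.head ⟨sdiff_subset hgy₂, hAC hzA, y₂, hy₂, hhy₂, ?_⟩ hreachz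
      intro u hu hyu e
      by_cases huz : u = z
      · subst huz
        rw [hh, update_self] at e
        exact hnotA hc₀ (e ▸ hzA)
      rw [hh, update_of_ne huz] at e
      by_cases huB : u ∈ B'
      · simp only [hh₁, if_pos huB] at e
        exact hnotA (hgB u huB) (e ▸ hzA)
      · simp only [hh₁, if_neg huB, hf₁] at e
        by_cases huy : u = y
        · exact hnadj (huy ▸ hyu.symm)
        · rw [update_of_ne huy] at e
          exact huz (huniq₂ u hu hyu e)
    refine ihN _ ?_ (sdiff_subset hc₀) hhC hph hhnear rfl
    rw [← hN]
    refine card_lt_card ((ssubset_iff_of_subset fun c hc => ?_).2 ⟨g y₂, hgy₂, fun hc => ?_⟩)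
    · rw [mem_sdiff] at hc
      refine hmemC hc.1 fun hcA => hc.2 (mem_filter.2 ⟨hc.1, ?_⟩)
      by_cases hcz : c = f z
      · exact hcz ▸ hreachz
      · exact hreach c hcA hcz
    · exact (mem_sdiff.1 hc).2 (mem_filter.2 ⟨sdiff_subset hgy₂, hreachy₂⟩)

lemma exists_classes_card_eq [Nonempty κ] (C : Finset κ) (s : ℕ) (S : Finset V)
    (hS : #S = #C * s) :
    ∃ f : V → κ, (∀ v ∈ S, f v ∈ C) ∧ ∀ c ∈ C, #{v ∈ S | f v = c} = s := by
  induction C using Finset.induction_on generalizing S with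
  | empty =>
    have : S = ∅ := by simpa using hS
    exact ⟨fun _ => Classical.arbitrary κ, by simp [this], by simp⟩
  | insert c C hc ih =>
    rw [card_insert_of_notMem hc, add_one_mul] at hS
    obtain ⟨T, hTS, hT⟩ := exists_subset_card_eq (by omega : s ≤ #S)
    obtain ⟨f, hf, hs⟩ := ih (S \ T) (by rw [card_sdiff_of_subset hTS]; omega)
    refine ⟨fun v => if v ∈ T then c else f v, fun v hv => ?_, fun d hd => ?_⟩
    · by_cases h : v ∈ T
      · simp [h]
      · simp [h, hf v (mem_sdiff.2 ⟨hv, h⟩)]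
    · rcases mem_insert.1 hd with rfl | hd
      · rw [← hT]
        congr 1
        ext v
        simp only [mem_filter]
        refine ⟨fun h => ?_, fun h => ⟨hTS h, by simp [h]⟩⟩
        by_contra hv
        have hvd : f v = d := by simpa [hv] using h.2
        exact hc (hvd ▸ hf v (mem_sdiff.2 ⟨h.1, hv⟩))
      · rw [← hs d hd]
        congr 1
        ext v
        have hcd : c ≠ d := by rintro rfl; exact hc hd
        by_cases hv : v ∈ T <;> simp [hv, hcd]

/-- The graph of the edges of `G` inside `T`. -/
def restrictTo (G : SimpleGraph V) (T : Finset V) : SimpleGraph V where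
  Adj u v := G.Adj u v ∧ u ∈ T ∧ v ∈ T
  symm := ⟨fun _ _ h => ⟨h.1.symm, h.2.2, h.2.1⟩⟩
  loopless := ⟨fun _ h => h.1.ne rfl⟩

/-- **Hajnal–Szemerédi theorem**: a graph with `#C * s` vertices, each of degree less than `#C`,
has a proper colouring by `C` with all classes of size `s`. -/
theorem exists_equitable [Nonempty κ] (G : SimpleGraph V) (S : Finset V) (C : Finset κ) (s : ℕ)
    (hS : #S = #C * s) (hdeg : ∀ v ∈ S, #{u ∈ S | G.Adj v u} < #C) :
    ∃ f, Equitable G S C s f := by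
  induction hN : #C using Nat.strong_induction_on generalizing G S C with
  | _ N ih =>
  subst hN
  suffices h : ∀ T ⊆ S, ∃ f, Equitable (restrictTo G T) S C s f by
    obtain ⟨f, hfC, hf, hs⟩ := h S Subset.rfl
    exact ⟨f, hfC, fun u hu v hv huv => hf u hu v hv ⟨huv, hu, hv⟩, hs⟩
  intro T
  induction T using Finset.induction_on with
  | empty =>
    obtain ⟨f, hfC, hs⟩ := exists_classes_card_eq C s S hS
    exact fun _ => ⟨f, hfC, fun u _ v _ huv => absurd huv.2.1 (notMem_empty u), hs⟩
  | insert x T hx ihT =>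
    intro hT
    have hxS : x ∈ S := hT (mem_insert_self x T)
    obtain ⟨f, hfC, hf, hs⟩ := ihT ((subset_insert x T).trans hT)
    obtain ⟨c, hc, hxc⟩ : ∃ c ∈ C, Movable G S f x c := by
      by_contra! hcon
      refine (hdeg x hxS).not_ge ((card_le_card fun c hc => ?_).trans (card_image_le (f := f)))
      have := hcon c hc
      simp only [Movable] at this
      push Not at this
      obtain ⟨u, hu, hxu, huc⟩ := this
      exact mem_image.2 ⟨u, mem_filter.2 ⟨hu, hxu⟩, huc⟩
    refine exists_equitable_of_near (f := update f x c) (lo := f x) (hi := c)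
      (fun C' hC' S' hS' hdeg' => ih _ hC' _ S' C' hS' hdeg' rfl) (fun v hv => ?_) (hfC x hxS) hc
      (fun v hv => ?_) (ProperOn.update (fun u hu v hv huv => ?_) fun u hu hxu => hxc u hu hxu.1)
      fun d hd => ?_
    · refine lt_of_le_of_lt (card_le_card fun u hu => ?_) (hdeg v hv)
      rw [mem_filter] at hu ⊢
      exact ⟨hu.1, hu.2.1⟩
    · by_cases hvx : v = x
      · subst hvx; rwa [update_self]
      · rw [update_of_ne hvx]; exact hfC v hv
    · rw [mem_erase] at hu hv
      refine hf u hu.2 v hv.2 ⟨huv.1, ?_, ?_⟩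
      · exact (mem_insert.1 huv.2.1).resolve_left hu.1
      · exact (mem_insert.1 huv.2.2).resolve_left hv.1
    · rw [card_update hxS c d, hs d hd]

end EquitableColoring

namespace Finset

/-- The number of `r`-sets meeting a given set `e` is at most `#e` times the number of `r`-sets
containing a given point. -/
lemma card_filter_not_disjoint_le {α : Type*} [Fintype α] [DecidableEq α] (r : ℕ)
    (G : Finset (Finset α)) (hG : ∀ f ∈ G, f.card = r + 1) (e : Finset α) :
    #{f ∈ G | ¬ Disjoint e f} ≤ #e * (Fintype.card α - 1).choose r := by
  have h1 : {f ∈ G | ¬ Disjoint e f} ⊆ e.biUnion fun v => {f ∈ G | v ∈ f} := by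
    intro f hf
    obtain ⟨hfG, hef⟩ := mem_filter.1 hf
    obtain ⟨v, hve, hvf⟩ := not_disjoint_iff.1 hef
    exact mem_biUnion.2 ⟨v, hve, mem_filter.2 ⟨hfG, hvf⟩⟩
  refine (card_le_card h1).trans (card_biUnion_le_card_mul _ _ _ fun v _ => ?_)
  have h2 : #(powersetCard r (univ.erase v)) = (Fintype.card α - 1).choose r := by
    rw [card_powersetCard, card_erase_of_mem (mem_univ v), card_univ]
  rw [← h2]
  refine card_le_card_of_injOn (fun f => f.erase v) (fun f hf => ?_) fun f hf g hg hfg => ?_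
  · obtain ⟨hfG, hvf⟩ := mem_filter.1 (mem_coe.1 hf)
    refine mem_coe.2 (mem_powersetCard.2 ⟨erase_subset_erase v (subset_univ f), ?_⟩)
    rw [card_erase_of_mem hvf, hG f hfG, Nat.add_sub_cancel]
  · rw [← insert_erase (mem_filter.1 (mem_coe.1 hf)).2,
      ← insert_erase (mem_filter.1 (mem_coe.1 hg)).2]
    exact congrArg (insert v) hfg

end Finset

lemma Nat.choose_le_choose_sub_add (n r j : ℕ) (hj : j ≤ n) :
    n.choose (r + 1) ≤ (n - j).choose (r + 1) + j * (n - 1).choose r := by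
  induction j with
  | zero => simp
  | succ j ih =>
    have h1 := ih (by omega)
    obtain ⟨m, hm⟩ : ∃ m, n - j = m + 1 := ⟨n - j - 1, by omega⟩
    have h2 : n - (j + 1) = m := by omega
    have h3 : m.choose r ≤ (n - 1).choose r := Nat.choose_le_choose r (by omega)
    rw [hm, Nat.choose_succ_succ'] at h1
    rw [h2, add_one_mul]
    omega

/-- For `k ≥ 1`, `r ≥ 2`, `n ≥ kr(k+r-2) + 2r - 1`: if `G` is an `r`-graph on `n`
vertices with `e(G) ≥ C(n,r) - (k-1)·[C(n,r) - C(n-k+1,r)]`, then the edge set of `G` can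
be partitioned into `⌊e(G)/k⌋` sets of `k` pairwise disjoint edges each, together with a
remainder set of `e(G) mod k` edges. -/
theorem partition_into_matchings (k r n : ℕ) (hk : 1 ≤ k) (hr : 2 ≤ r)
    (hn : k * r * (k + r - 2) + 2 * r - 1 ≤ n)
    (G : Finset (Finset (Fin n))) (hG : ∀ e ∈ G, e.card = r)
    (hcard : (n.choose r : ℤ) -
        ((k : ℤ) - 1) * ((n.choose r : ℤ) - ((n - k + 1).choose r : ℤ)) ≤ (G.card : ℤ)) :
    ∃ P : Finset (Finset (Finset (Fin n))),
      (∀ p ∈ P, p ⊆ G ∧ IsMatchingSet k p) ∧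
      (∀ p ∈ P, ∀ q ∈ P, p ≠ q → Disjoint p q) ∧
      P.card = G.card / k ∧
      (G \ P.biUnion id).card = G.card % k := by
  obtain ⟨j, rfl⟩ := Nat.exists_eq_add_of_le' hk
  obtain ⟨t, rfl⟩ := Nat.exists_eq_add_of_le' (by omega : 1 ≤ r)
  have hn' : (j + 1) * (t + 1) * (j + t) + 2 * t + 1 ≤ n := by
    have : j + 1 + (t + 1) - 2 = j + t := by omega
    rw [this] at hn
    omega
  have hjn : j < n := by
    nlinarith [Nat.zero_le (j * t), Nat.zero_le (j * j * t), Nat.zero_le (j * j)]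
  set d := (n - 1).choose t
  have hmul : n * d = n.choose (t + 1) * (t + 1) := by
    obtain ⟨m, rfl⟩ : ∃ m, n = m + 1 := ⟨n - 1, by omega⟩
    exact Nat.add_one_mul_choose_eq m t
  have hlarge : (j + 1) * ((t + 1) * d) ≤ G.card := by
    have h1 := Nat.choose_le_choose_sub_add n t j hjn.le
    have h2 : n - (j + 1) + 1 = n - j := by omega
    rw [h2] at hcard
    zify at h1 hmul hn' ⊢
    push_cast at hcard
    have h3 : (n.choose (t + 1) : ℤ) - j * (j * d) ≤ G.card := by
      refine le_trans ?_ hcard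
      have : (j : ℤ) * (n.choose (t + 1) - (n - j).choose (t + 1)) ≤ j * (j * d) :=
        mul_le_mul_of_nonneg_left (by linarith) (by positivity)
      linarith
    refine le_trans ?_ h3
    have h4 : ((j + 1) * (t + 1) * (j + t) + 2 * t + 1 : ℤ) * d ≤ n.choose (t + 1) * (t + 1) := by
      rw [← hmul]
      exact mul_le_mul_of_nonneg_right hn' (by positivity)
    have h5 : (0 : ℤ) ≤ t * d := by positivity
    have h6 : (0 : ℤ) < t + 1 := by positivity
    refine le_of_mul_le_mul_right ?_ h6
    linarith
  set q := G.card / (j + 1)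
  have hdq : (t + 1) * d ≤ q := (Nat.le_div_iff_mul_le (by omega)).2 (by linarith)
  obtain ⟨S, hSG, hS⟩ := Finset.exists_subset_card_eq (Nat.div_mul_le_self G.card (j + 1))
  obtain ⟨H, hH⟩ : ∃ H : SimpleGraph (Finset (Fin n)), ∀ e f, H.Adj e f ↔ e ≠ f ∧ ¬ Disjoint e f :=
    ⟨{ Adj := fun e f => e ≠ f ∧ ¬ Disjoint e f
       symm := ⟨fun _ _ h => ⟨h.1.symm, fun h' => h.2 h'.symm⟩⟩
       loopless := ⟨fun _ h => h.1 rfl⟩ }, fun _ _ => Iff.rfl⟩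
  obtain ⟨c, hcC, hc, hcs⟩ := EquitableColoring.exists_equitable H S (Finset.range q) (j + 1)
    (by rw [hS, Finset.card_range]) fun e he => by
      classical
      rw [Finset.card_range]
      have h1 := Finset.card_filter_not_disjoint_le t S (fun f hf => hG f (hSG hf)) e
      rw [hG e (hSG he), Fintype.card_fin] at h1
      refine lt_of_lt_of_le (Finset.card_lt_card ?_) (h1.trans hdq)
      refine (Finset.ssubset_iff_of_subset fun f hf => ?_).2 ⟨e, ?_, ?_⟩
      · rw [Finset.mem_filter] at hf ⊢
        exact ⟨hf.1, ((hH e f).1 hf.2).2⟩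
      · rw [Finset.mem_filter, disjoint_self, Finset.bot_eq_empty, ← Finset.card_eq_zero,
          hG e (hSG he)]
        exact ⟨he, by omega⟩
      · rw [Finset.mem_filter]
        exact fun h => h.2.ne rfl
  have hcs' : ∀ i ∈ Finset.range q, ({e ∈ S | c e = i} : Finset _).card = j + 1 :=
    fun i hi => by convert hcs i hi
  have hunion : ((Finset.range q).image fun i => {e ∈ S | c e = i}).biUnion id = S := by
    ext e
    simp only [Finset.mem_biUnion, Finset.mem_image, id]
    constructor
    · rintro ⟨_, ⟨i, _, rfl⟩, he⟩
      exact (Finset.mem_filter.1 he).1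
    · exact fun he => ⟨_, ⟨c e, hcC e he, rfl⟩, Finset.mem_filter.2 ⟨he, rfl⟩⟩
  refine ⟨(Finset.range q).image fun i => {e ∈ S | c e = i}, ?_, ?_, ?_, ?_⟩
  · simp only [Finset.mem_image]
    rintro _ ⟨i, hi, rfl⟩
    refine ⟨(Finset.filter_subset _ _).trans hSG, hcs' i hi, fun e he f hf hef => ?_⟩
    rw [Finset.mem_filter] at he hf
    by_contra hdis
    exact hc e he.1 f hf.1 ((hH e f).2 ⟨hef, hdis⟩) (he.2.trans hf.2.symm)
  · simp only [Finset.mem_image]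
    rintro _ ⟨i, _, rfl⟩ _ ⟨i', _, rfl⟩ hne
    rw [Finset.disjoint_filter]
    rintro e _ rfl rfl
    exact hne rfl
  · rw [Finset.card_image_of_injOn, Finset.card_range]
    intro i hi i' _ hii'
    obtain ⟨e, he⟩ := Finset.card_pos.1
      (by rw [hcs' i hi]; omega : 0 < ({e ∈ S | c e = i} : Finset _).card)
    have he' := he
    simp only at hii'
    rw [hii'] at he'
    exact (Finset.mem_filter.1 he).2.symm.trans (Finset.mem_filter.1 he').2
  · rw [hunion, Finset.card_sdiff_of_subset hSG, hS]
    have := Nat.div_add_mod' G.card (j + 1)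
    omega
end

section
/- Let k ≥ 1 and r ≥ 2 be integers and n ≥ kr(k+r−2) + 2r − 1. Then k·C(n−r, r) + (k−1)·C(n−k+1, r) ≥ (2k−2)·C(n, r). -/
theorem Nat.choose_add_le_choose_add_mul (m s t N : ℕ) (h : m + s ≤ N + 1) :
    (m + s).choose (t + 1) ≤ m.choose (t + 1) + s * N.choose t := by
  induction s with
  | zero => simp
  | succ s ih =>
    have h1 := ih (by omega)
    have h2 : (m + s).choose t ≤ N.choose t := Nat.choose_le_choose t (by omega)
    rw [← add_assoc, Nat.choose_succ_succ', add_mul]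
    omega

/-- For `k ≥ 1`, `r ≥ 2` and `n ≥ kr(k+r-2) + 2r - 1`,
`k·C(n-r, r) + (k-1)·C(n-k+1, r) ≥ (2k-2)·C(n, r)`. -/
theorem binom_ineq (k r n : ℕ) (hk : 1 ≤ k) (hr : 2 ≤ r)
    (hn : k * r * (k + r - 2) + 2 * r - 1 ≤ n) :
    (2 * k - 2) * n.choose r ≤ k * (n - r).choose r + (k - 1) * (n - k + 1).choose r := by
  obtain ⟨j, rfl⟩ : ∃ j, k = j + 1 := ⟨k - 1, by omega⟩
  obtain ⟨t, rfl⟩ : ∃ t, r = t + 1 := ⟨r - 1, by omega⟩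
  obtain ⟨N, rfl⟩ : ∃ N, n = N + 1 := ⟨n - 1, by omega⟩
  rw [show j + 1 + (t + 1) - 2 = j + t by omega] at hn
  have hn' : (t + 1) * ((j + 1) * (t + 1) + j ^ 2) ≤ N + 1 := by
    have : (j + 1) * (t + 1) * (j + t) + 2 * (t + 1) ≤ N + 1 + 1 := by omega
    nlinarith
  have hjtN : j + t ≤ N := by
    have := Nat.le_mul_of_pos_left (j + t) (Nat.mul_pos j.succ_pos t.succ_pos)
    simp only [Nat.succ_eq_add_one] at this
    omega
  have h₁ := Nat.choose_add_le_choose_add_mul (N + 1 - (t + 1)) (t + 1) t N (by omega)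
  have h₂ := Nat.choose_add_le_choose_add_mul (N + 1 - (j + 1) + 1) j t N (by omega)
  rw [show N + 1 - (t + 1) + (t + 1) = N + 1 by omega] at h₁
  rw [show N + 1 - (j + 1) + 1 + j = N + 1 by omega] at h₂
  have hmain : ((j + 1) * (t + 1) + j ^ 2) * N.choose t ≤ (N + 1).choose (t + 1) := by
    refine Nat.le_of_mul_le_mul_left ?_ t.succ_pos
    calc (t + 1) * (((j + 1) * (t + 1) + j ^ 2) * N.choose t)
        ≤ (N + 1) * N.choose t := by
          rw [← mul_assoc]; exact Nat.mul_le_mul_right _ hn'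
      _ = (t + 1) * (N + 1).choose (t + 1) := by
          rw [Nat.add_one_mul_choose_eq, mul_comm]
  rw [show 2 * (j + 1) - 2 = 2 * j by omega, Nat.add_sub_cancel]
  have h₃ := Nat.mul_le_mul_left (j + 1) h₁
  have h₄ := Nat.mul_le_mul_left j h₂
  linarith
end

section
/- Let k ≥ 1 and r ≥ 2 be integers, let H be the r-uniform hypergraph consisting of exactly k pairwise disjoint edges, and let n ≥ (2k−1)r − (k−1). For every r-graph G on n vertices, e(G) − k·p_H(G) ≤ C(n, r) − C(n−k+1, r), where p_H(G) is the maximum number of pairwise edge-disjoint copies of H in G. -/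
/-- `p_H(G)`: the maximum number of pairwise edge-disjoint copies of `H` in `G`, where `H`
consists of `k` pairwise disjoint edges. -/
noncomputable def pH (k : ℕ) {n : ℕ} (G : Finset (Finset (Fin n))) : ℕ :=
  sSup {m | ∃ F : Finset (Finset (Finset (Fin n))),
    (∀ p ∈ F, p ⊆ G ∧ IsMatchingSet k p) ∧
    (∀ p ∈ F, ∀ q ∈ F, p ≠ q → Disjoint p q) ∧ F.card = m}

open Finset

/-- `F` contains `m` pairwise disjoint members (indexed by `Fin m`). -/
def HasMatching (m : ℕ) (F : Finset (Finset ℕ)) : Prop :=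
  ∃ f : Fin m → Finset ℕ, (∀ a, f a ∈ F) ∧ ∀ a b, a ≠ b → Disjoint (f a) (f b)

/-- `F` is closed under replacing an element by a smaller element of `Y`. -/
def IsShifted (Y : Finset ℕ) (F : Finset (Finset ℕ)) : Prop :=
  ∀ e ∈ F, ∀ i ∈ Y, ∀ j ∈ e, i < j → i ∉ e → insert i (e.erase j) ∈ F

/-- The `(i, j)`-shift of a member `e` of the family `F`. -/
def shiftEdge (i j : ℕ) (F : Finset (Finset ℕ)) (e : Finset ℕ) : Finset ℕ :=
  if j ∈ e ∧ i ∉ e ∧ insert i (e.erase j) ∉ F then insert i (e.erase j) else e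

lemma image_swap_of_mem_of_notMem {i j : ℕ} {e : Finset ℕ} (hj : j ∈ e) (hi : i ∉ e) :
    e.image (Equiv.swap i j) = insert i (e.erase j) := by
  ext x
  simp only [mem_image, mem_insert, mem_erase]
  constructor
  · rintro ⟨y, hy, rfl⟩
    by_cases h1 : y = j
    · subst h1; simp
    · have h2 : y ≠ i := fun h => hi (h ▸ hy)
      rw [Equiv.swap_apply_of_ne_of_ne h2 h1]; exact Or.inr ⟨h1, hy⟩
  · rintro (rfl | ⟨h1, h2⟩)
    · exact ⟨j, hj, by simp⟩
    · exact ⟨x, h2, Equiv.swap_apply_of_ne_of_ne (fun h => hi (h ▸ h2)) h1⟩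

lemma image_swap_of_notMem {i j : ℕ} {e : Finset ℕ} (hj : j ∉ e) (hi : i ∉ e) :
    e.image (Equiv.swap i j) = e := by
  conv_rhs => rw [← image_id (s := e)]
  refine image_congr fun y hy => ?_
  exact Equiv.swap_apply_of_ne_of_ne (fun h => hi (h ▸ hy)) (fun h => hj (h ▸ hy))

lemma erase_insert_insert_erase {i j : ℕ} {e : Finset ℕ} (hj : j ∈ e) (hi : i ∉ e) :
    insert j ((insert i (e.erase j)).erase i) = e := by
  rw [erase_insert (by simp [hi]), insert_erase hj]

lemma shiftEdge_injOn (i j : ℕ) (F : Finset (Finset ℕ)) :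
    Set.InjOn (shiftEdge i j F) (F : Set (Finset ℕ)) := by
  intro e he e' he' h
  simp only [mem_coe] at he he'
  unfold shiftEdge at h
  split_ifs at h with h1 h2 h2
  · rw [← erase_insert_insert_erase h1.1 h1.2.1, h, erase_insert_insert_erase h2.1 h2.2.1]
  · exact absurd (h ▸ he') h1.2.2
  · exact absurd (h ▸ he) h2.2.2
  · exact h

lemma HasMatching.of_image_shiftEdge {m i j : ℕ} {F : Finset (Finset ℕ)} (hij : i < j)
    (h : HasMatching m (F.image (shiftEdge i j F))) : HasMatching m F := by
  obtain ⟨f, hf, hd⟩ := h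
  have key : ∀ b, (f b ∈ F ∧ (j ∈ f b → i ∉ f b → insert i ((f b).erase j) ∈ F)) ∨
      ∃ e ∈ F, j ∈ e ∧ i ∉ e ∧ f b = insert i (e.erase j) := by
    intro b
    obtain ⟨e, he, heq⟩ := mem_image.1 (hf b)
    unfold shiftEdge at heq
    split_ifs at heq with h1
    · exact Or.inr ⟨e, he, h1.1, h1.2.1, heq.symm⟩
    · subst heq
      refine Or.inl ⟨he, fun h2 h3 => ?_⟩
      by_contra h4
      exact h1 ⟨h2, h3, h4⟩
  by_cases hall : ∀ a, f a ∈ F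
  · exact ⟨f, hall, hd⟩
  push Not at hall
  obtain ⟨a, ha⟩ := hall
  obtain ⟨e, he, hje, hie, hae⟩ := (key a).resolve_left (fun h => ha h.1)
  have hia : i ∈ f a := by rw [hae]; simp
  refine ⟨fun b => (f b).image (Equiv.swap i j), fun b => ?_, fun b c hbc => ?_⟩
  · by_cases hb : b = a
    · subst hb
      have hj' : j ∉ f b := by rw [hae]; simp [hij.ne']
      have := image_swap_of_mem_of_notMem hia hj'
      rw [Equiv.swap_comm] at this
      simp only [this]
      rwa [hae, erase_insert_insert_erase hje hie]
    · have hib : i ∉ f b := fun h => disjoint_left.1 (hd b a hb) h hia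
      have hb' := (key b).resolve_right (fun ⟨e', _, _, _, h⟩ => hib (by rw [h]; simp))
      by_cases hjb : j ∈ f b
      · simp only [image_swap_of_mem_of_notMem hjb hib]
        exact hb'.2 hjb hib
      · simp only [image_swap_of_notMem hjb hib]
        exact hb'.1
  · exact (disjoint_image (Equiv.injective _)).2 (hd b c hbc)

lemma shiftEdge_mem_powersetCard {r n i j : ℕ} {F : Finset (Finset ℕ)} {e : Finset ℕ}
    (hij : i < j) (he : e ∈ powersetCard r (range n)) :
    shiftEdge i j F e ∈ powersetCard r (range n) := by
  unfold shiftEdge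
  split_ifs with h
  · obtain ⟨h1, h2⟩ := mem_powersetCard.1 he
    refine mem_powersetCard.2 ⟨?_, ?_⟩
    · intro x hx
      rcases mem_insert.1 hx with rfl | hx
      · exact mem_range.2 (hij.trans (mem_range.1 (h1 h.1)))
      · exact h1 (mem_of_mem_erase hx)
    · rw [card_insert_of_notMem (by simp [h.2.1]), card_erase_of_mem h.1, h2]
      have := card_pos.2 ⟨j, h.1⟩
      omega
  · exact he

lemma sum_insert_erase_lt {i j : ℕ} {e : Finset ℕ} (hij : i < j) (hj : j ∈ e) (hi : i ∉ e) :
    ∑ x ∈ insert i (e.erase j), x < ∑ x ∈ e, x := by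
  rw [sum_insert (by simp [hi]), ← add_sum_erase e (fun x => x) hj]
  omega

/-- Shifting: a uniform family may be replaced by a shifted one of the same size, without
creating larger matchings. -/
lemma exists_isShifted (m r n : ℕ) (F : Finset (Finset ℕ)) (hF : F ⊆ powersetCard r (range n))
    (hm : ¬ HasMatching m F) :
    ∃ F' : Finset (Finset ℕ), F' ⊆ powersetCard r (range n) ∧ ¬ HasMatching m F' ∧
      F'.card = F.card ∧ IsShifted (range n) F' := by
  induction hw : ∑ e ∈ F, ∑ x ∈ e, x using Nat.strong_induction_on generalizing F with
  | _ w ih =>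
    by_cases hs : IsShifted (range n) F
    · exact ⟨F, hF, hm, rfl, hs⟩
    unfold IsShifted at hs
    push Not at hs
    obtain ⟨e, he, i, -, j, hj, hij, hi, hn⟩ := hs
    have hlt : ∑ e ∈ F.image (shiftEdge i j F), ∑ x ∈ e, x < w := by
      rw [sum_image (shiftEdge_injOn i j F), ← hw]
      refine sum_lt_sum (fun e' _ => ?_) ⟨e, he, ?_⟩
      · unfold shiftEdge
        split_ifs with h
        · exact (sum_insert_erase_lt hij h.1 h.2.1).le
        · exact le_rfl
      · unfold shiftEdge
        rw [if_pos ⟨hj, hi, hn⟩]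
        exact sum_insert_erase_lt hij hj hi
    obtain ⟨F', h1, h2, h3, h4⟩ := ih _ hlt (F.image (shiftEdge i j F))
      (image_subset_iff.2 fun e' he' => shiftEdge_mem_powersetCard hij (hF he'))
      (fun h => hm (h.of_image_shiftEdge hij)) rfl
    exact ⟨F', h1, h2, h3.trans (card_image_of_injOn (shiftEdge_injOn i j F)), h4⟩

/-- Double counting of the pairs consisting of a member and a shadow element below it. -/
lemma card_mul_le_card_shadow_mul_of_subset {k : ℕ} {Y : Finset ℕ} {F : Finset (Finset ℕ)}
    (hF : F ⊆ powersetCard k Y) :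
    F.card * k ≤ F.shadow.card * (Y.card - (k - 1)) := by
  refine card_mul_le_card_mul (fun e g => g ⊆ e) (fun e he => ?_) (fun g hg => ?_)
  · rw [← (mem_powersetCard.1 (hF he)).2]
    rw [← card_image_of_injOn (erase_injOn e)]
    refine card_le_card fun g hg => ?_
    obtain ⟨a, ha, rfl⟩ := mem_image.1 hg
    exact mem_bipartiteAbove _ |>.2 ⟨mem_shadow_iff.2 ⟨e, he, a, ha, rfl⟩, erase_subset _ _⟩
  · obtain ⟨e, he, a, ha, rfl⟩ := mem_shadow_iff.1 hg
    obtain ⟨heY, hek⟩ := mem_powersetCard.1 (hF he)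
    have hc : (e.erase a).card = k - 1 := by rw [card_erase_of_mem ha, hek]
    have hk : 1 ≤ k := hek ▸ card_pos.2 ⟨a, ha⟩
    have hsub : e.erase a ⊆ Y := (erase_subset _ _).trans heY
    rw [← hc, ← card_sdiff_of_subset hsub]
    refine (card_le_card (t := (Y \ e.erase a).image (fun x => insert x (e.erase a)))
      fun f hf => ?_).trans card_image_le
    obtain ⟨hf, hs⟩ := mem_bipartiteBelow _ |>.1 hf
    obtain ⟨hfY, hfk⟩ := mem_powersetCard.1 (hF hf)
    have h1 : (f \ e.erase a).card = 1 := by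
      rw [card_sdiff_of_subset hs, hc, hfk]; omega
    obtain ⟨x, hx⟩ := card_eq_one.1 h1
    have hxf : x ∈ f \ e.erase a := by rw [hx]; simp
    refine mem_image.2 ⟨x, mem_sdiff.2 ⟨hfY (mem_sdiff.1 hxf).1, (mem_sdiff.1 hxf).2⟩, ?_⟩
    rw [insert_eq, ← hx, sdiff_union_of_subset hs]

/-- Frankl's shadow bound, for shifted families: a uniform family without `s + 1` pairwise
disjoint members has at most `s` times as many members as its shadow. -/
lemma card_le_mul_card_shadow (s : ℕ) (Y : Finset ℕ) : ∀ (k : ℕ) (F : Finset (Finset ℕ)), 1 ≤ k →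
    F ⊆ powersetCard k Y → IsShifted Y F → ¬ HasMatching (s + 1) F →
    F.card ≤ s * F.shadow.card := by
  induction Y using Finset.induction_on_max with
  | empty =>
    intro k F hk hF _ _
    have : F = ∅ := by
      rw [← subset_empty]
      refine hF.trans (subset_of_eq ?_)
      exact powersetCard_eq_empty.2 (by simpa using Nat.pos_of_ne_zero (by omega))
    simp [this]
  | insert y Y hy ih =>
    intro k F hk hF hS hM
    have hyY : y ∉ Y := fun h => lt_irrefl _ (hy y h)
    by_cases hcard : (insert y Y).card < k * (s + 1)
    · have h1 := card_mul_le_card_shadow_mul_of_subset hF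
      have h2 : (insert y Y).card - (k - 1) ≤ k * s := by
        rw [mul_add] at hcard; omega
      have h3 : F.card * k ≤ (s * F.shadow.card) * k :=
        (h1.trans (Nat.mul_le_mul_left _ h2)).trans (le_of_eq (by ring))
      exact Nat.le_of_mul_le_mul_right h3 hk
    push Not at hcard
    rw [card_insert_of_notMem hyY] at hcard
    rcases hk.eq_or_lt with rfl | hk2
    · have hFs : F.card ≤ s := by
        by_contra hlt
        push Not at hlt
        obtain ⟨f⟩ : Nonempty (Fin (s + 1) ↪ F) :=
          Function.Embedding.nonempty_of_card_le (by simpa using hlt)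
        refine hM ⟨fun a => (f a : Finset ℕ), fun a => (f a).2, fun a b hab => ?_⟩
        obtain ⟨x, hx⟩ := card_eq_one.1 (mem_powersetCard.1 (hF (f a).2)).2
        obtain ⟨z, hz⟩ := card_eq_one.1 (mem_powersetCard.1 (hF (f b).2)).2
        simp only [hx, hz, disjoint_singleton]
        rintro rfl
        exact hab (f.injective (Subtype.ext (hx.trans hz.symm)))
      rcases F.eq_empty_or_nonempty with rfl | ⟨e, he⟩
      · simp
      obtain ⟨x, hx⟩ := card_pos.1 (by rw [(mem_powersetCard.1 (hF he)).2]; exact one_pos)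
      have : 1 ≤ F.shadow.card := card_pos.2 ⟨_, mem_shadow_iff.2 ⟨e, he, x, hx, rfl⟩⟩
      nlinarith
    set A := F.filter (fun e => y ∉ e) with hA
    set B := (F.filter (fun e => y ∈ e)).image (fun e => e.erase y) with hB
    have memB : ∀ g, g ∈ B ↔ y ∉ g ∧ insert y g ∈ F := by
      intro g
      simp only [hB, mem_image, mem_filter]
      constructor
      · rintro ⟨e, ⟨h1, h2⟩, rfl⟩
        exact ⟨by simp, by rwa [insert_erase h2]⟩
      · rintro ⟨h1, h2⟩
        exact ⟨_, ⟨h2, by simp⟩, by rw [erase_insert h1]⟩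
    have hcardF : F.card = A.card + B.card := by
      rw [hB, card_image_of_injOn, add_comm, hA, card_filter_add_card_filter_not]
      intro e he e' he' h
      simp only [coe_filter, Set.mem_ofPred_eq] at he he'
      rw [← insert_erase he.2, ← insert_erase he'.2]
      exact congrArg _ h
    have hAu : A ⊆ powersetCard k Y := by
      intro e he
      obtain ⟨he, hye⟩ := mem_filter.1 he
      obtain ⟨h1, h2⟩ := mem_powersetCard.1 (hF he)
      exact mem_powersetCard.2 ⟨(subset_insert_iff_of_notMem hye).1 h1, h2⟩
    have hBu : B ⊆ powersetCard (k - 1) Y := by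
      intro g hg
      obtain ⟨hyg, hg⟩ := (memB g).1 hg
      obtain ⟨h1, h2⟩ := mem_powersetCard.1 (hF hg)
      rw [card_insert_of_notMem hyg] at h2
      refine mem_powersetCard.2 ⟨?_, by omega⟩
      exact (subset_insert_iff_of_notMem hyg).1 ((subset_insert _ _).trans h1)
    have hAs : IsShifted Y A := by
      intro e he i hi j hj hij hie
      obtain ⟨he, hye⟩ := mem_filter.1 he
      refine mem_filter.2 ⟨hS e he i (mem_insert_of_mem hi) j hj hij hie, ?_⟩
      have := hy i hi
      simp [hye, this.ne']
    have hBs : IsShifted Y B := by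
      intro g hg i hi j hj hij hig
      obtain ⟨hyg, hg'⟩ := (memB g).1 hg
      have hiy := hy i hi
      have hjy : j ≠ y := fun h => hyg (h ▸ hj)
      refine (memB _).2 ⟨by simp [hyg, hiy.ne'], ?_⟩
      have := hS _ hg' i (mem_insert_of_mem hi) j (mem_insert_of_mem hj) hij
        (by simp [hig, hiy.ne])
      rwa [erase_insert_of_ne hjy.symm, insert_comm] at this
    have hAM : ¬ HasMatching (s + 1) A := fun ⟨f, h1, h2⟩ =>
      hM ⟨f, fun a => (mem_filter.1 (h1 a)).1, h2⟩
    have hBM : ¬ HasMatching (s + 1) B := by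
      rintro ⟨f, h1, h2⟩
      have hU : (univ.biUnion f).card ≤ (s + 1) * (k - 1) := by
        refine card_biUnion_le.trans ((sum_le_card_nsmul _ _ (k - 1) fun a _ => ?_).trans ?_)
        · exact (mem_powersetCard.1 (hBu (h1 a))).2.le
        · simp
      have hR : s + 1 ≤ (insert y Y \ univ.biUnion f).card := by
        have := le_card_sdiff (univ.biUnion f) (insert y Y)
        rw [card_insert_of_notMem hyY] at this
        obtain ⟨k', rfl⟩ : ∃ k', k = k' + 1 := ⟨k - 1, by omega⟩
        simp only [Nat.add_sub_cancel] at hU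
        have h3 : (k' + 1) * (s + 1) = (s + 1) * k' + (s + 1) := by ring
        omega
      obtain ⟨x⟩ : Nonempty (Fin (s + 1) ↪ (insert y Y \ univ.biUnion f : Finset ℕ)) :=
        Function.Embedding.nonempty_of_card_le (by simpa using hR)
      have hxn : ∀ a b, (x a : ℕ) ∉ f b := fun a b h =>
        (mem_sdiff.1 (x a).2).2 (mem_biUnion.2 ⟨b, mem_univ _, h⟩)
      refine hM ⟨fun a => insert (x a : ℕ) (f a), fun a => ?_, fun a b hab => ?_⟩
      · obtain ⟨hyf, hfF⟩ := (memB _).1 (h1 a)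
        by_cases hxy : (x a : ℕ) = y
        · simpa only [hxy] using hfF
        · have hxY : (x a : ℕ) ∈ Y := (mem_insert.1 (mem_sdiff.1 (x a).2).1).resolve_left hxy
          have := hS _ hfF (x a) (mem_insert_of_mem hxY) y (mem_insert_self _ _) (hy _ hxY)
            (by simp [hxy, hxn])
          rwa [erase_insert hyf] at this
      · have hne : (x a : ℕ) ≠ x b := fun h => hab (x.injective (Subtype.ext h))
        simp only [disjoint_insert_left, disjoint_insert_right, mem_insert, hxn, not_or]
        exact ⟨⟨hne.symm, not_false⟩, not_false, h2 a b hab⟩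
    have hA1 := ih k A hk hAu hAs hAM
    have hB1 := ih (k - 1) B (by omega) hBu hBs hBM
    have hsh : A.shadow.card + B.shadow.card ≤ F.shadow.card := by
      have hyB : ∀ g ∈ B.shadow, y ∉ g := by
        intro g hg
        obtain ⟨e, he, a, ha, rfl⟩ := mem_shadow_iff.1 hg
        exact fun h => ((memB e).1 he).1 (mem_of_mem_erase h)
      have hinj : Set.InjOn (insert y) (B.shadow : Set (Finset ℕ)) := by
        intro g hg g' hg' h
        rw [← erase_insert (hyB g hg), ← erase_insert (hyB g' hg'), h]
      rw [← card_image_of_injOn hinj, ← card_union_of_disjoint]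
      · refine card_le_card (union_subset ?_ ?_)
        · exact shadow_monotone (filter_subset _ _)
        · intro g' hg'
          obtain ⟨g, hg, rfl⟩ := mem_image.1 hg'
          obtain ⟨e, he, a, ha, rfl⟩ := mem_shadow_iff.1 hg
          obtain ⟨hye, he⟩ := (memB e).1 he
          refine mem_shadow_iff.2 ⟨_, he, a, mem_insert_of_mem ha, ?_⟩
          rw [erase_insert_of_ne]
          rintro rfl
          exact hye ha
      · rw [disjoint_left]
        intro g hg hg'
        obtain ⟨e, he, a, ha, rfl⟩ := mem_shadow_iff.1 hg
        obtain ⟨g', hg', h⟩ := mem_image.1 hg'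
        have : y ∈ e.erase a := h ▸ mem_insert_self _ _
        exact (mem_filter.1 he).2 (mem_of_mem_erase this)
    rw [hcardF]
    nlinarith

/-- For a fixed subset `B` of `Y`, the images of `B` under the permutations of `Y` are
uniformly distributed over the subsets of `Y` of the size of `B`. -/
lemma card_filter_perm_image_mem_mul_choose (Y : Finset ℕ) (B : Finset Y) (A : Finset (Finset ℕ))
    (hA : A ⊆ powersetCard B.card Y) :
    (univ.filter fun σ : Equiv.Perm Y => B.image (fun y => (σ y : ℕ)) ∈ A).card *
      Y.card.choose B.card = A.card * Y.card.factorial := by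
  set img : Equiv.Perm Y → Finset ℕ := fun σ => B.image (fun y => (σ y : ℕ))
  have inj : ∀ σ : Equiv.Perm Y, Function.Injective (fun y => (σ y : ℕ)) := fun σ =>
    Subtype.val_injective.comp σ.injective
  have himgcard : ∀ σ, (img σ).card = B.card := fun σ => card_image_of_injective _ (inj σ)
  have fib : ∀ A : Finset (Finset ℕ), (univ.filter fun σ => img σ ∈ A).card =
      ∑ a ∈ A, (univ.filter fun σ => img σ = a).card := by
    intro A
    rw [card_eq_sum_card_fiberwise (f := img) (t := A) (fun σ hσ => by simpa using hσ)]
    refine sum_congr rfl fun a ha => ?_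
    congr 1
    ext σ
    simp only [mem_filter, mem_univ, true_and, and_iff_right_iff_imp]
    rintro rfl
    exact ha
  have le : ∀ a ∈ powersetCard B.card Y, ∀ a' ∈ powersetCard B.card Y,
      (univ.filter fun σ => img σ = a).card ≤ (univ.filter fun σ => img σ = a').card := by
    intro a ha a' ha'
    obtain ⟨h1, h2⟩ := mem_powersetCard.1 ha
    obtain ⟨h1', h2'⟩ := mem_powersetCard.1 ha'
    have cnt : ∀ c : Finset ℕ, c ⊆ Y → Fintype.card {y : Y // (y : ℕ) ∈ c} = c.card := by
      intro c hc
      rw [Fintype.card_subtype, ← card_map (Function.Embedding.subtype (· ∈ Y))]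
      congr 1
      ext x
      simp only [mem_map, mem_filter, mem_univ, true_and, Function.Embedding.subtype_apply,
        Subtype.exists, exists_and_left, exists_prop]
      constructor
      · rintro ⟨z, hz, _, rfl⟩; exact hz
      · exact fun hx => ⟨x, hx, hc hx, rfl⟩
    let e : {y : Y // (y : ℕ) ∈ a} ≃ {y : Y // (y : ℕ) ∈ a'} :=
      Fintype.equivOfCardEq (by rw [cnt a h1, cnt a' h1', h2, h2'])
    refine card_le_card_of_injOn (fun σ => σ.trans e.extendSubtype) (fun σ hσ => ?_)
      (fun σ _ σ' _ h => ?_)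
    · simp only [coe_filter, mem_univ, true_and, Set.mem_ofPred_eq] at hσ ⊢
      refine eq_of_subset_of_card_le (fun x hx => ?_) (by rw [h2', himgcard])
      obtain ⟨y, hy, rfl⟩ := mem_image.1 hx
      have : (σ y : ℕ) ∈ a := hσ ▸ mem_image_of_mem (fun y => (σ y : ℕ)) hy
      exact e.extendSubtype_mem (σ y) this
    · ext y
      have := congrArg (fun τ : Equiv.Perm Y => τ y) h
      simp only [Equiv.trans_apply] at this
      rw [e.extendSubtype.injective this]
  rcases A.eq_empty_or_nonempty with rfl | ⟨a₀, ha₀⟩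
  · simp
  have const : ∀ a ∈ powersetCard B.card Y, (univ.filter fun σ => img σ = a).card =
      (univ.filter fun σ => img σ = a₀).card := fun a ha =>
    le_antisymm (le a ha a₀ (hA ha₀)) (le a₀ (hA ha₀) a ha)
  have tot := fib (powersetCard B.card Y)
  rw [sum_congr rfl const, sum_const, card_powersetCard, smul_eq_mul, filter_true_of_mem,
    card_univ, Fintype.card_perm, Fintype.card_coe] at tot
  · rw [fib A, sum_congr rfl fun a ha => const a (hA ha), sum_const, smul_eq_mul, tot]
    ring
  · intro σ _
    refine mem_powersetCard.2 ⟨fun x hx => ?_, himgcard σ⟩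
    obtain ⟨y, _, rfl⟩ := mem_image.1 hx
    exact (σ y).2

/-- If the sets `N 0, …, N s` have no system of distinct representatives, then some `N i` has
size at most `s - i`. -/
lemma exists_card_le_of_forall_not_injective {α : Type*} [DecidableEq α] (s : ℕ)
    (N : ℕ → Finset α)
    (h : ∀ g : Fin (s + 1) → α, Function.Injective g → ¬ ∀ a : Fin (s + 1), g a ∈ N a) :
    ∃ i ≤ s, (N i).card ≤ s - i := by
  by_contra! hc
  obtain ⟨g, hg, hg'⟩ := (all_card_le_biUnion_card_iff_exists_injective
    (fun a : Fin (s + 1) => N a)).1 (by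
      intro S
      rcases S.eq_empty_or_nonempty with rfl | hS
      · simp
      set i := S.min' hS
      have hle : S ⊆ Finset.Ici i := fun x hx => mem_Ici.2 (S.min'_le x hx)
      have h1 := card_le_card hle
      rw [Fin.card_Ici] at h1
      have h2 := hc i (by omega)
      have h3 : (N i).card ≤ (S.biUnion fun a => N a).card :=
        card_le_card (subset_biUnion_of_mem (fun a : Fin (s + 1) => N a) (S.min'_mem hS))
      omega)
  exact h g hg hg'

/-- Weighted size bound for a decreasing chain of subsets of a `(2 * s + 1)`-set without a
system of distinct representatives. -/
lemma sum_card_add_le_of_forall_not_injective (s : ℕ) (N : ℕ → Finset (Fin (2 * s + 1)))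
    (hN : ∀ i j, i ≤ j → j ≤ s → N j ⊆ N i)
    (h : ∀ g : Fin (s + 1) → Fin (2 * s + 1), Function.Injective g →
      ¬ ∀ a : Fin (s + 1), g a ∈ N a) :
    ∑ i ∈ range s, (N i).card + (s + 1) * (N s).card ≤ s * (2 * s + 1) := by
  obtain ⟨i, his, hi⟩ := exists_card_le_of_forall_not_injective s N h
  obtain ⟨d, rfl⟩ := Nat.exists_eq_add_of_le his
  rw [Nat.add_sub_cancel_left] at hi
  have h1 : ∀ j, (N j).card ≤ 2 * (i + d) + 1 := fun j => by simpa using card_le_univ (N j)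
  have h2 : ∀ j, i ≤ j → j ≤ i + d → (N j).card ≤ d := fun j h1 h2 =>
    (card_le_card (hN i j h1 h2)).trans hi
  rw [sum_range_add]
  have h3 : ∑ j ∈ range i, (N j).card ≤ i * (2 * (i + d) + 1) := by
    simpa using sum_le_card_nsmul (range i) (fun j => (N j).card) _ fun j _ => h1 j
  have h4 : ∑ j ∈ range d, (N (i + j)).card ≤ d * d := by
    simpa using sum_le_card_nsmul (range d) (fun j => (N (i + j)).card) d
      fun j hj => h2 _ (by omega) (by have := mem_range.1 hj; omega)
  have h5 := Nat.mul_le_mul_left (i + d + 1) (h2 (i + d) (by omega) le_rfl)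
  nlinarith

/-- Frankl's inequality for a decreasing chain of cross-dependent uniform families. -/
lemma sum_card_add_le_mul_choose (s l : ℕ) (Y : Finset ℕ) (hY : (2 * s + 1) * l ≤ Y.card)
    (F : ℕ → Finset (Finset ℕ)) (hF : ∀ i, F i ⊆ powersetCard l Y)
    (hmono : ∀ i j, i ≤ j → j ≤ s → F j ⊆ F i)
    (hcross : ∀ f : Fin (s + 1) → Finset ℕ, (∀ a b, a ≠ b → Disjoint (f a) (f b)) →
      ¬ ∀ a : Fin (s + 1), f a ∈ F a) :
    ∑ i ∈ range s, (F i).card + (s + 1) * (F s).card ≤ s * Y.card.choose l := by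
  obtain ⟨φ⟩ : Nonempty ((Fin (2 * s + 1) × Fin l) ↪ Y) :=
    Function.Embedding.nonempty_of_card_le (by simpa using hY)
  let B : Fin (2 * s + 1) → Finset Y := fun j => univ.image fun a => φ (j, a)
  have hBcard : ∀ j, (B j).card = l := fun j => by
    rw [card_image_of_injective _ (fun a b hab => by simpa using φ.injective hab)]
    simp
  have hBdisj : ∀ i j, i ≠ j → Disjoint (B i) (B j) := by
    intro i j hij
    rw [disjoint_left]
    intro x hx hx'
    obtain ⟨a, _, rfl⟩ := mem_image.1 hx
    obtain ⟨b, _, hb⟩ := mem_image.1 hx'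
    exact hij (congrArg Prod.fst (φ.injective hb)).symm
  let N : Equiv.Perm Y → ℕ → Finset (Fin (2 * s + 1)) := fun σ i =>
    univ.filter fun j => (B j).image (fun y => (σ y : ℕ)) ∈ F i
  have hN : ∀ σ, ∑ i ∈ range s, (N σ i).card + (s + 1) * (N σ s).card ≤ s * (2 * s + 1) := by
    intro σ
    refine sum_card_add_le_of_forall_not_injective s (N σ) (fun i j hij hj x hx => ?_)
      (fun g hg hgN => ?_)
    · exact mem_filter.2 ⟨mem_univ _, hmono i j hij hj (mem_filter.1 hx).2⟩
    · refine hcross (fun a => (B (g a)).image (fun y => (σ y : ℕ))) (fun a b hab => ?_)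
        (fun a => (mem_filter.1 (hgN a)).2)
      exact (disjoint_image (Subtype.val_injective.comp σ.injective)).2
        (hBdisj _ _ fun h => hab (hg h))
  have hsum : ∀ i, (∑ σ, (N σ i).card) * Y.card.choose l =
      (2 * s + 1) * ((F i).card * Y.card.factorial) := by
    intro i
    have : ∑ σ, (N σ i).card = ∑ j, (univ.filter fun σ : Equiv.Perm Y =>
        (B j).image (fun y => (σ y : ℕ)) ∈ F i).card := by
      simp only [N, card_filter]
      exact sum_comm
    rw [this, sum_mul]
    have : ∀ j, (univ.filter fun σ : Equiv.Perm Y =>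
        (B j).image (fun y => (σ y : ℕ)) ∈ F i).card * Y.card.choose l =
        (F i).card * Y.card.factorial := by
      intro j
      have := card_filter_perm_image_mem_mul_choose Y (B j) (F i) (by rw [hBcard]; exact hF i)
      rwa [hBcard] at this
    simp only [this, sum_const, card_univ, Fintype.card_fin, smul_eq_mul]
  have htot : (∑ σ, (∑ i ∈ range s, (N σ i).card + (s + 1) * (N σ s).card)) * Y.card.choose l ≤
      (Y.card.factorial * (s * (2 * s + 1))) * Y.card.choose l := by
    refine Nat.mul_le_mul_right _ ((sum_le_card_nsmul _ _ _ fun σ _ => hN σ).trans (le_of_eq ?_))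
    rw [card_univ, Fintype.card_perm, Fintype.card_coe, smul_eq_mul]
  rw [sum_add_distrib, sum_comm, ← mul_sum, add_mul, sum_mul, mul_assoc, hsum] at htot
  simp only [hsum] at htot
  rw [← mul_sum, ← sum_mul] at htot
  have hpos : 0 < (2 * s + 1) * Y.card.factorial := Nat.mul_pos (by omega) (Nat.factorial_pos _)
  refine Nat.le_of_mul_le_mul_right (le_trans (le_of_eq ?_) (htot.trans (le_of_eq ?_))) hpos <;>
    ring

/-- The sets in `F` meeting `range (s + 1)` exactly in `i`, with `i` removed. -/
def link (s r n : ℕ) (F : Finset (Finset ℕ)) (i : ℕ) : Finset (Finset ℕ) :=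
  (powersetCard (r - 1) (Ico (s + 1) n)).filter fun g => insert i g ∈ F

lemma card_link {s r n i : ℕ} {F : Finset (Finset ℕ)} (hF : F ⊆ powersetCard r (range n))
    (hi : i ∈ range (s + 1)) :
    (link s r n F i).card = (F.filter fun e => e ∩ range (s + 1) = {i}).card := by
  have hi' := mem_range.1 hi
  refine card_nbij' (insert i) (fun e => e.erase i) ?_ ?_ ?_ ?_
  · intro g hg
    obtain ⟨hg, hgF⟩ := mem_filter.1 hg
    refine mem_filter.2 ⟨hgF, ?_⟩
    ext x
    simp only [mem_inter, mem_insert, mem_range, mem_singleton]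
    constructor
    · rintro ⟨rfl | hx, hxs⟩
      · rfl
      · have := mem_Ico.1 ((mem_powersetCard.1 hg).1 hx)
        omega
    · rintro rfl
      exact ⟨Or.inl rfl, hi'⟩
  · intro e he
    obtain ⟨heF, he⟩ := mem_filter.1 he
    obtain ⟨h1, h2⟩ := mem_powersetCard.1 (hF heF)
    have hie : i ∈ e := (mem_inter.1 (by rw [he]; simp : i ∈ e ∩ range (s + 1))).1
    refine mem_filter.2 ⟨mem_powersetCard.2 ⟨fun x hx => ?_, ?_⟩, ?_⟩
    · obtain ⟨hxi, hx⟩ := mem_erase.1 hx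
      refine mem_Ico.2 ⟨?_, mem_range.1 (h1 hx)⟩
      by_contra hlt
      have : x ∈ e ∩ range (s + 1) := mem_inter.2 ⟨hx, mem_range.2 (by omega)⟩
      rw [he] at this
      exact hxi (mem_singleton.1 this)
    · rw [card_erase_of_mem hie, h2]
    · simpa only [insert_erase hie] using heF
  · intro g hg
    refine erase_insert fun h => ?_
    have := mem_Ico.1 ((mem_powersetCard.1 (mem_filter.1 hg).1).1 h)
    omega
  · intro e he
    obtain ⟨-, he⟩ := mem_filter.1 he
    exact insert_erase (mem_inter.1 (by rw [he]; simp : i ∈ e ∩ range (s + 1))).1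

/-- Splitting a uniform family according to the intersections with `range (s + 1)`. -/
lemma card_eq_card_filter_add_sum_card_link {s r n : ℕ} {F : Finset (Finset ℕ)}
    (hF : F ⊆ powersetCard r (range n)) :
    F.card = (F.filter fun e => 2 ≤ (e ∩ range (s + 1)).card).card +
      ∑ i ∈ range (s + 1), (link s r n F i).card +
      (F.filter fun e => e ⊆ Ico (s + 1) n).card := by
  rw [sum_congr rfl fun i hi => card_link hF hi]
  simp only [card_filter]
  rw [sum_comm, ← sum_add_distrib, ← sum_add_distrib, card_eq_sum_ones]
  refine sum_congr rfl fun e he => ?_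
  have hsub : e ⊆ Ico (s + 1) n ↔ (e ∩ range (s + 1)).card = 0 := by
    rw [card_eq_zero, ← disjoint_iff_inter_eq_empty, disjoint_left]
    have hn := (mem_powersetCard.1 (hF he)).1
    constructor
    · intro h x hx hxs
      have := mem_Ico.1 (h hx)
      have := mem_range.1 hxs
      omega
    · intro h x hx
      have h1 := h hx
      rw [mem_range] at h1
      exact mem_Ico.2 ⟨by omega, mem_range.1 (hn hx)⟩
  simp only [hsub]
  rcases Nat.lt_trichotomy (e ∩ range (s + 1)).card 1 with h | h | h
  · have h0 : (e ∩ range (s + 1)).card = 0 := by omega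
    have h0' := card_eq_zero.1 h0
    rw [h0']
    simp [eq_comm (a := (∅ : Finset ℕ))]
  · obtain ⟨x, hx⟩ := card_eq_one.1 h
    have hxm : x < s + 1 := mem_range.1 (mem_inter.1 (by rw [hx]; simp : x ∈ e ∩ range (s + 1))).2
    rw [hx]
    simp [hxm]
  · have h2 : 2 ≤ (e ∩ range (s + 1)).card := h
    have : ∀ i ∈ range (s + 1), (if e ∩ range (s + 1) = {i} then 1 else 0) = 0 := by
      intro i _
      refine if_neg fun hi => ?_
      rw [hi, card_singleton] at h2
      omega
    rw [sum_eq_zero this, if_pos h2, if_neg (by omega), add_zero, add_zero]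

/-- Frankl's theorem on the Erdős matching conjecture: a uniform family without `s + 1` pairwise
disjoint members has at most as many members as there are sets meeting a fixed `s`-set. -/
lemma card_add_choose_le_of_not_hasMatching {s r n : ℕ} (hr : 1 ≤ r)
    (hn : (2 * s + 1) * (r - 1) + (s + 1) ≤ n) {F : Finset (Finset ℕ)}
    (hF : F ⊆ powersetCard r (range n)) (hM : ¬ HasMatching (s + 1) F) :
    F.card + (n - s).choose r ≤ n.choose r := by
  obtain ⟨F', hF', hM', hc, hS⟩ := exists_isShifted (s + 1) r n F hF hM
  rw [← hc]
  clear hc hF hM F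
  rename' F' => F, hF' => hF, hM' => hM
  have memY : ∀ {x}, x ∈ Ico (s + 1) n ↔ s + 1 ≤ x ∧ x < n := mem_Ico
  have hYcard : (Ico (s + 1) n).card = n - (s + 1) := Nat.card_Ico _ _
  have notMem : ∀ {g i}, g ⊆ Ico (s + 1) n → i ≤ s → i ∉ g := fun hg hi h => by
    have := memY.1 (hg h)
    omega
  have hlink : ∀ i, link s r n F i ⊆ powersetCard (r - 1) (Ico (s + 1) n) := fun i =>
    filter_subset _ _
  have hlinks := sum_card_add_le_mul_choose s (r - 1) (Ico (s + 1) n) (by omega)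
    (link s r n F) hlink (by
      intro i j hij hj g hgl
      obtain ⟨hg, hgF⟩ := mem_filter.1 hgl
      rcases hij.eq_or_lt with rfl | hij
      · exact hgl
      have hgY := (mem_powersetCard.1 hg).1
      have := hS _ hgF i (mem_range.2 (by omega)) j (mem_insert_self _ _) hij
        (by simp [hij.ne, notMem hgY (hij.le.trans hj)])
      rw [erase_insert (notMem hgY hj)] at this
      exact mem_filter.2 ⟨hg, this⟩) (by
      intro f hd hf
      have hfY : ∀ a, f a ⊆ Ico (s + 1) n := fun a => (mem_powersetCard.1 (hlink _ (hf a))).1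
      refine hM ⟨fun a => insert (a : ℕ) (f a), fun a => (mem_filter.1 (hf a)).2,
        fun a b hab => ?_⟩
      have hab' : (b : ℕ) ≠ a := fun h => hab (Fin.ext h.symm)
      rw [disjoint_insert_left, disjoint_insert_right, mem_insert, not_or]
      exact ⟨⟨hab'.symm, notMem (hfY b) (by omega)⟩, notMem (hfY a) (by omega), hd a b hab⟩)
  have hempty : (F.filter fun e => e ⊆ Ico (s + 1) n).card ≤ s * (link s r n F s).card := by
    refine (card_le_mul_card_shadow s (Ico (s + 1) n) r _ hr ?_ ?_ ?_).trans
      (Nat.mul_le_mul_left _ (card_le_card ?_))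
    · intro e he
      obtain ⟨he, heY⟩ := mem_filter.1 he
      exact mem_powersetCard.2 ⟨heY, (mem_powersetCard.1 (hF he)).2⟩
    · intro e he i hi j hj hij hie
      obtain ⟨he, heY⟩ := mem_filter.1 he
      exact mem_filter.2 ⟨hS e he i (mem_range.2 (memY.1 hi).2) j hj hij hie,
        insert_subset hi ((erase_subset _ _).trans heY)⟩
    · rintro ⟨f, hf, hd⟩
      exact hM ⟨f, fun a => (mem_filter.1 (hf a)).1, hd⟩
    · intro g hg
      obtain ⟨e, he, x, hx, rfl⟩ := mem_shadow_iff.1 hg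
      obtain ⟨he, heY⟩ := mem_filter.1 he
      have hxY := memY.1 (heY hx)
      refine mem_filter.2 ⟨mem_powersetCard.2 ⟨(erase_subset _ _).trans heY, ?_⟩, ?_⟩
      · rw [card_erase_of_mem hx, (mem_powersetCard.1 (hF he)).2]
      · exact hS e he s (mem_range.2 (by omega)) x hx (by omega) (notMem heY le_rfl)
  have hFc := card_eq_card_filter_add_sum_card_link (s := s) hF
  have hPc := card_eq_card_filter_add_sum_card_link (s := s)
    (Subset.refl (powersetCard r (range n)))
  have hPlink : ∀ i ∈ range (s + 1), (link s r n (powersetCard r (range n)) i).card =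
      (n - (s + 1)).choose (r - 1) := by
    intro i hi
    have hi := mem_range.1 hi
    rw [link, filter_true_of_mem, card_powersetCard, hYcard]
    intro g hg
    obtain ⟨h1, h2⟩ := mem_powersetCard.1 hg
    refine mem_powersetCard.2 ⟨insert_subset (mem_range.2 (by omega)) fun x hx =>
      mem_range.2 (memY.1 (h1 hx)).2, ?_⟩
    rw [card_insert_of_notMem (notMem h1 (by omega)), h2]
    omega
  have hPempty : ((powersetCard r (range n)).filter fun e => e ⊆ Ico (s + 1) n).card =
      (n - (s + 1)).choose r := by
    rw [← hYcard, ← card_powersetCard]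
    congr 1
    ext e
    simp only [mem_filter, mem_powersetCard]
    exact ⟨fun h => ⟨h.2, h.1.2⟩, fun h =>
      ⟨⟨fun x hx => mem_range.2 (memY.1 (h.1 hx)).2, h.2⟩, h.1⟩⟩
  rw [sum_congr rfl hPlink, hPempty, sum_const, card_powersetCard, card_range, card_range,
    smul_eq_mul] at hPc
  have h2 : (F.filter fun e => 2 ≤ (e ∩ range (s + 1)).card).card ≤
      ((powersetCard r (range n)).filter fun e => 2 ≤ (e ∩ range (s + 1)).card).card :=
    card_le_card (filter_subset_filter _ hF)
  have hpascal : (n - s).choose r = (n - (s + 1)).choose (r - 1) + (n - (s + 1)).choose r := by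
    obtain ⟨m, hm⟩ : ∃ m, n = m + (s + 1) := ⟨n - (s + 1), by omega⟩
    obtain ⟨q, rfl⟩ : ∃ q, r = q + 1 := ⟨r - 1, by omega⟩
    have h1 : n - s = m + 1 := by omega
    have h2 : n - (s + 1) = m := by omega
    rw [h1, h2, Nat.choose_succ_succ, Nat.add_sub_cancel]
  rw [sum_range_succ] at hFc
  rw [hYcard] at hlinks
  rw [hpascal, hPc, hFc]
  nlinarith

/-- There are `pH k G` pairwise edge-disjoint copies; removing them leaves a family with no
further copy. -/
lemma exists_subset_card_eq_and_not_isMatchingSet {k n : ℕ} (hk : 1 ≤ k)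
    (G : Finset (Finset (Fin n))) :
    ∃ G' ⊆ G, G.card = G'.card + k * pH k G ∧ ∀ p ⊆ G', ¬ IsMatchingSet k p := by
  let S : Set ℕ := {m | ∃ F : Finset (Finset (Finset (Fin n))),
    (∀ p ∈ F, p ⊆ G ∧ IsMatchingSet k p) ∧
    (∀ p ∈ F, ∀ q ∈ F, p ≠ q → Disjoint p q) ∧ F.card = m}
  have hbdd : BddAbove S := by
    refine ⟨Fintype.card (Finset (Finset (Fin n))), ?_⟩
    rintro m ⟨F, -, -, rfl⟩
    exact card_le_univ F
  have hmem : pH k G ∈ S := Nat.sSup_mem ⟨0, ∅, by simp⟩ hbdd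
  obtain ⟨F, hFG, hFd, hFc⟩ := hmem
  have hU : F.biUnion id ⊆ G := biUnion_subset.2 fun p hp => (hFG p hp).1
  refine ⟨G \ F.biUnion id, sdiff_subset, ?_, fun p hp hpk => ?_⟩
  · have h1 : (F.biUnion id).card = k * pH k G := by
      rw [card_biUnion (t := id) hFd,
        sum_congr rfl fun p hp => show (id p).card = k from (hFG p hp).2.1, sum_const, hFc,
        smul_eq_mul, mul_comm]
    rw [← h1, card_sdiff_add_card_eq_card hU]
  · have hdis : ∀ q ∈ F, Disjoint p q := fun q hq => disjoint_left.2 fun e he heq =>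
      (mem_sdiff.1 (hp he)).2 (mem_biUnion.2 ⟨q, hq, heq⟩)
    have hpF : p ∉ F := fun h => by
      have h0 : p = ∅ := disjoint_self.1 (hdis p h)
      have := hpk.1
      rw [h0, card_empty] at this
      omega
    have : (insert p F).card ∈ S := by
      refine ⟨insert p F, fun q hq => ?_, fun q hq q' hq' hne => ?_, rfl⟩
      · rcases mem_insert.1 hq with rfl | hq
        · exact ⟨hp.trans sdiff_subset, hpk⟩
        · exact hFG q hq
      · rcases mem_insert.1 hq with h1 | hq <;> rcases mem_insert.1 hq' with h2 | hq'
        · exact absurd (h1.trans h2.symm) hne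
        · exact h1 ▸ hdis q' hq'
        · exact h2 ▸ (hdis q hq).symm
        · exact hFd q hq q' hq' hne
    have hle : (insert p F).card ≤ pH k G := le_csSup hbdd this
    rw [card_insert_of_notMem hpF] at hle
    omega

lemma not_hasMatching_image_val {k r n : ℕ} (hr : 1 ≤ r) {G : Finset (Finset (Fin n))}
    (hG : ∀ e ∈ G, e.card = r) (h : ∀ p ⊆ G, ¬ IsMatchingSet k p) :
    ¬ HasMatching k (G.image fun e => e.image Fin.val) := by
  rintro ⟨f, hf, hd⟩
  choose g hgG hg using fun a => mem_image.1 (hf a)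
  have hdg : ∀ a b, a ≠ b → Disjoint (g a) (g b) := fun a b hab => by
    have := hd a b hab
    rw [← hg a, ← hg b] at this
    exact (disjoint_image Fin.val_injective).1 this
  have hinj : Function.Injective g := by
    intro a b hab
    by_contra hne
    have h1 := hdg a b hne
    rw [hab, disjoint_self] at h1
    have h2 := hG _ (hgG b)
    rw [h1, bot_eq_empty, card_empty] at h2
    omega
  refine h (univ.image g) (image_subset_iff.2 fun a _ => hgG a) ⟨?_, ?_⟩
  · rw [card_image_of_injective _ hinj, card_univ, Fintype.card_fin]
  · intro e he e' he' hne
    obtain ⟨a, -, rfl⟩ := mem_image.1 he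
    obtain ⟨b, -, rfl⟩ := mem_image.1 he'
    exact hdg a b fun hab => hne (hab ▸ rfl)

/-- For `k ≥ 1`, `r ≥ 2`, `n ≥ (2k-1)r - (k-1)`, and every `r`-graph `G` on `n` vertices,
`e(G) - k·p_H(G) ≤ C(n,r) - C(n-k+1,r)`, where `H` is the `r`-graph consisting of exactly
`k` pairwise disjoint edges. -/
theorem card_sub_k_pH_le (k r n : ℕ) (hk : 1 ≤ k) (hr : 2 ≤ r)
    (hn : (2 * k - 1) * r - (k - 1) ≤ n)
    (G : Finset (Finset (Fin n))) (hG : ∀ e ∈ G, e.card = r) :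
    (G.card : ℤ) - (k : ℤ) * (pH k G : ℤ) ≤
      (n.choose r : ℤ) - ((n - k + 1).choose r : ℤ) := by
  obtain ⟨G', hG'G, hcard, hG'⟩ := exists_subset_card_eq_and_not_isMatchingSet hk G
  obtain ⟨s, rfl⟩ : ∃ s, k = s + 1 := ⟨k - 1, by omega⟩
  obtain ⟨q, rfl⟩ : ∃ q, r = q + 1 := ⟨r - 1, by omega⟩
  have hn' : (2 * s + 1) * q + (s + 1) ≤ n := by
    have h1 : 2 * (s + 1) - 1 = 2 * s + 1 := by omega
    rw [h1, mul_add] at hn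
    omega
  have hG'r : ∀ e ∈ G', e.card = q + 1 := fun e he => hG e (hG'G he)
  have key := card_add_choose_le_of_not_hasMatching (s := s) (r := q + 1) (n := n)
    (F := G'.image fun e => e.image Fin.val) (by omega) hn' (by
      intro e' he'
      obtain ⟨e, he, rfl⟩ := mem_image.1 he'
      refine mem_powersetCard.2 ⟨fun x hx => ?_, ?_⟩
      · obtain ⟨y, -, rfl⟩ := mem_image.1 hx
        exact mem_range.2 y.2
      · rw [card_image_of_injective _ Fin.val_injective, hG'r e he])
    (not_hasMatching_image_val (by omega) hG'r hG')
  rw [card_image_of_injective _ (image_injective Fin.val_injective)] at key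
  have h2 : n - (s + 1) + 1 = n - s := by omega
  rw [h2, hcard]
  push_cast
  have key' : (G'.card : ℤ) + ((n - s).choose (q + 1) : ℤ) ≤ (n.choose (q + 1) : ℤ) := by
    exact_mod_cast key
  linarith
end
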